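/- arXiv:1305.6691 — 2 statements merged into one kernel-verified Lean document; each statement's English description precedes it below -/
import Mathlib

section
/- Let X be a real Banach space, let A : X ⇉ X* be a maximally monotone linear relation (i.e., gra A is a linear subspace of X × X*), and let B : X ⇉ X* be maximally monotone with dom A ∩ int(dom B) ≠ ∅. Then A + B is maximally monotone. -/
open Set Filter Topology

noncomputable section

variable {X : Type*} [NormedAddCommGroup X] [NormedSpace ℝ X]

/-- A set-valued operator `A : X ⇉ X*`, identified with its graph,
is monotone if `⟨x − y, x* − y*⟩ ≥ 0` for all `(x, x*), (y, y*)` in the graph. -/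
def IsMonotoneOp (A : Set (X × (X →L[ℝ] ℝ))) : Prop :=
  ∀ p ∈ A, ∀ q ∈ A, 0 ≤ (p.2 - q.2) (p.1 - q.1)

/-- `A` is maximally monotone if it is monotone and its graph is not properly contained
in the graph of any monotone operator. -/
def IsMaxMonotoneOp (A : Set (X × (X →L[ℝ] ℝ))) : Prop :=
  IsMonotoneOp A ∧ ∀ B : Set (X × (X →L[ℝ] ℝ)), IsMonotoneOp B → A ⊆ B → B = A

/-- The domain of a set-valued operator. -/
def opDom (A : Set (X × (X →L[ℝ] ℝ))) : Set X :=
  {x | ∃ xs, (x, xs) ∈ A}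

/-- `(z, z*)` is monotonically related to `S` if `⟨z − y, z* − y*⟩ ≥ 0` for all `(y, y*) ∈ S`. -/
def MonotonicallyRelated (S : Set (X × (X →L[ℝ] ℝ))) (p : X × (X →L[ℝ] ℝ)) : Prop :=
  ∀ q ∈ S, 0 ≤ (p.2 - q.2) (p.1 - q.1)

/-- A maximally monotone operator `A` is of type (FPV) if for every open convex set `U`
meeting `dom A`, every `(x, x*)` with `x ∈ U` monotonically related to
`gra A ∩ (U × X*)` belongs to `gra A`. -/
def IsFPV (A : Set (X × (X →L[ℝ] ℝ))) : Prop :=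
  IsMaxMonotoneOp A ∧
    ∀ U : Set X, IsOpen U → Convex ℝ U → (U ∩ opDom A).Nonempty →
      ∀ x : X, ∀ xs : X →L[ℝ] ℝ, x ∈ U →
        MonotonicallyRelated (A ∩ (U ×ˢ (univ : Set (X →L[ℝ] ℝ)))) (x, xs) →
        (x, xs) ∈ A

/-- The graph of the sum `A + B`: `(A + B)x = {a* + b* : a* ∈ A x, b* ∈ B x}`. -/
def opSum (A B : Set (X × (X →L[ℝ] ℝ))) : Set (X × (X →L[ℝ] ℝ)) :=
  {p | ∃ as bs, (p.1, as) ∈ A ∧ (p.1, bs) ∈ B ∧ p.2 = as + bs}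

/-- The star (centre) of a set `C`: points `x ∈ C` with `[x, c] ⊆ C` for all `c ∈ C`. -/
def starSet (C : Set X) : Set X :=
  {x ∈ C | ∀ c ∈ C, segment ℝ x c ⊆ C}

/-- The Fitzpatrick function of `A`:
`F_A(x, x*) = sup_{(a, a*) ∈ gra A} (⟨x, a*⟩ + ⟨a, x*⟩ − ⟨a, a*⟩)`, with values in `(−∞, +∞]`. -/
def fitz (A : Set (X × (X →L[ℝ] ℝ))) (p : X × (X →L[ℝ] ℝ)) : EReal :=
  ⨆ q ∈ A, ((q.2 p.1 + p.2 q.1 - q.2 q.1 : ℝ) : EReal)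


lemma aux_max_mem {A : Set (X × (X →L[ℝ] ℝ))} (hA : IsMaxMonotoneOp A) {x : X} {xs : X →L[ℝ] ℝ}
    (h : ∀ y ys, (y, ys) ∈ A → 0 ≤ (xs - ys) (x - y)) : (x, xs) ∈ A := by
  have hm : IsMonotoneOp (insert (x, xs) A) := by
    intro p hp q hq
    rcases hp with rfl | hp <;> rcases hq with rfl | hq
    · simp
    · exact h _ _ hq
    · have := h _ _ hp
      have e : (p.2 - xs) (p.1 - x) = (xs - p.2) (x - p.1) := by
        simp only [sub_apply, map_sub]; ring
      simpa [e] using this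
    · exact hA.1 p hp q hq
  have := hA.2 _ hm (subset_insert _ _)
  rw [← this]
  exact mem_insert _ _

lemma aux_sandwich {P Q : Set (X × ℝ)} (hP : Convex ℝ P) (hQ : Convex ℝ Q)
    (h : ∀ x α β, (x, α) ∈ P → (x, β) ∈ Q → 0 ≤ α + β)
    {x0 : X} {r M α0 : ℝ} (hr : 0 < r) (hx0 : (x0, α0) ∈ P)
    (hball : ∀ u, ‖u - x0‖ < r → ∃ β ≤ M, (u, β) ∈ Q) :
    ∃ w : X →L[ℝ] ℝ, ∀ x α u β, (x, α) ∈ P → (u, β) ∈ Q → 0 ≤ α + β + w (u - x) := by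
  set O : Set (X × ℝ) := {o | ∃ p ∈ P, ∃ q ∈ Q, o.1 = q.1 - p.1 ∧ p.2 + q.2 < o.2} with hO
  have hOc : Convex ℝ O := by
    rintro o ⟨p, hp, q, hq, h1, h2⟩ o' ⟨p', hp', q', hq', h1', h2'⟩ a b ha hb hab
    refine ⟨_, hP hp hp' ha hb hab, _, hQ hq hq' ha hb hab, ?_, ?_⟩
    · simp only [Prod.fst_add, Prod.smul_fst, h1, h1', smul_sub]; abel
    · simp only [Prod.snd_add, Prod.smul_snd, smul_eq_mul]
      rcases ha.eq_or_lt with rfl | ha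
      · have : b = 1 := by linarith
        subst this; linarith
      · nlinarith [mul_lt_mul_of_pos_left h2 ha, mul_le_mul_of_nonneg_left h2'.le hb]
  have h0 : (0 : X × ℝ) ∉ O := by
    rintro ⟨⟨x, α⟩, hp, ⟨u, β⟩, hq, h1, h2⟩
    simp only [Prod.fst_zero, Prod.snd_zero] at h1 h2
    have : u = x := (sub_eq_zero.1 h1.symm)
    subst this
    linarith [h _ _ _ hp hq]
  have hint : ((0 : X), α0 + M + 1) ∈ interior O := by
    rw [mem_interior]
    refine ⟨Metric.ball 0 r ×ˢ Ioi (α0 + M), ?_, Metric.isOpen_ball.prod isOpen_Ioi, ?_⟩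
    · rintro ⟨v, γ⟩ ⟨hv, hγ⟩
      simp only [mem_ball_zero_iff, mem_Ioi] at hv hγ
      obtain ⟨β, hβ, hq⟩ := hball (x0 + v) (by simpa using hv)
      exact ⟨_, hx0, _, hq, by simp, by simp only; linarith⟩
    · simp [hr]
  obtain ⟨f, hf⟩ := geometric_hahn_banach_open_point hOc.interior isOpen_interior
    (fun hh => h0 (interior_subset hh))
  have hf2 : ∀ o ∈ O, f o ≤ 0 := by
    intro o ho
    have hc : closure (interior O) ⊆ f ⁻¹' (Iic 0) := closure_minimal
      (fun x hx => by have := hf x hx; rw [map_zero] at this; exact this.le)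
      (isClosed_Iic.preimage f.continuous)
    rw [hOc.closure_interior_eq_closure_of_nonempty_interior ⟨_, hint⟩] at hc
    exact hc (subset_closure ho)
  set c := f ((0 : X), (1 : ℝ)) with hc
  have hdec : ∀ x γ, f (x, γ) = f (x, 0) + γ * c := by
    intro x γ
    have : ((x, γ) : X × ℝ) = (x, 0) + γ • ((0 : X), (1 : ℝ)) := by simp
    rw [this, map_add, map_smul, smul_eq_mul]
  have hcneg : c < 0 := by
    by_contra hcn
    push Not at hcn
    have hin := hf _ hint
    have hs : f ((0 : X), α0 + M + 1 + 1) ≤ f 0 := by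
      rw [map_zero]
      apply hf2
      obtain ⟨β, hβ, hq⟩ := hball x0 (by simpa using hr)
      exact ⟨_, hx0, _, hq, by simp, by simp only; linarith⟩
    rw [map_zero, hdec] at hin
    have z0 : f ((0 : X), (0 : ℝ)) = 0 := map_zero f
    obtain ⟨β, hβ, hq⟩ := hball x0 (by simpa using hr)
    have := h _ _ _ hx0 hq
    rw [z0] at hin
    nlinarith
  refine ⟨c⁻¹ • f.comp (ContinuousLinearMap.inl ℝ X ℝ), ?_⟩
  intro x α u β hp hq
  have key : ∀ ε > 0, 0 ≤ α + β + ε + c⁻¹ * f (u - x, 0) := by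
    intro ε hε
    have := hf2 (u - x, α + β + ε) ⟨_, hp, _, hq, rfl, by simp only; linarith⟩
    rw [hdec] at this
    have h3 := mul_nonneg_of_nonpos_of_nonpos (inv_lt_zero.2 hcneg).le this
    rw [mul_add, mul_comm _ c, ← mul_assoc, inv_mul_cancel₀ hcneg.ne] at h3
    linarith
  have : 0 ≤ α + β + c⁻¹ * f (u - x, 0) :=
    le_of_forall_pos_le_add fun ε hε => by linarith [key ε hε]
  simpa using this

lemma aux_baire [CompleteSpace X] {C : ℕ → Set X} (hcl : ∀ n, IsClosed (C n))
    (hcv : ∀ n, Convex ℝ (C n)) (hmono : Monotone C) {s : Set X} (hs : s ⊆ ⋃ n, C n)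
    {x0 : X} (hx0 : x0 ∈ interior s) : ∃ n, x0 ∈ interior (C n) := by
  have cover : ∀ v : X, ∃ p : ℕ × ℕ, x0 + (1 / ((p.2 : ℝ) + 1)) • v ∈ C p.1 := by
    intro v
    have ht : Tendsto (fun m : ℕ => x0 + (1 / ((m : ℝ) + 1)) • v) atTop (𝓝 x0) := by
      simpa using (tendsto_one_div_add_atTop_nhds_zero_nat (𝕜 := ℝ)).smul_const v |>.const_add x0
    obtain ⟨m, hm⟩ := (ht.eventually (mem_interior_iff_mem_nhds.1 hx0)).exists
    obtain ⟨n, hn⟩ := mem_iUnion.1 (hs hm)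
    exact ⟨(n, m), hn⟩
  obtain ⟨⟨n, m⟩, v0, hv0⟩ := nonempty_interior_of_iUnion_of_closed
    (f := fun p : ℕ × ℕ => {v : X | x0 + (1 / ((p.2 : ℝ) + 1)) • v ∈ C p.1})
    (fun p => (hcl p.1).preimage (by fun_prop))
    (by ext v; simpa using cover v)
  set a : ℝ := 1 / ((m : ℝ) + 1) with ha
  have hapos : 0 < a := by positivity
  have hu : x0 + a • v0 ∈ interior (C n) := by
    have hop : IsOpenMap (fun v : X => x0 + a • v) :=
      (isOpenMap_add_left x0).comp (isOpenMap_smul₀ hapos.ne')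
    have : (fun v : X => x0 + a • v) '' interior {v : X | x0 + a • v ∈ C n} ⊆ interior (C n) := by
      apply interior_maximal _ (hop _ isOpen_interior)
      rintro _ ⟨v, hv, rfl⟩
      exact (interior_subset hv : v ∈ {v : X | x0 + a • v ∈ C n})
    exact this ⟨v0, hv0, rfl⟩
  obtain ⟨⟨k, j⟩, hk⟩ := cover (-(a • v0))
  set b : ℝ := 1 / ((j : ℝ) + 1) with hb
  have hbpos : 0 < b := by positivity
  refine ⟨max n k, ?_⟩
  have h1 := interior_mono (hmono (le_max_left n k)) hu
  have h2 := hmono (le_max_right n k) hk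
  have h3 := (hcv (max n k)).combo_interior_self_mem_interior h1 h2
    (a := b / (1 + b)) (b := 1 / (1 + b)) (by positivity) (by positivity) (by field_simp; ring)
  convert h3 using 1
  have e1 : (1 / (1 + b)) * b = b / (1 + b) := by ring
  have e2 : b / (1 + b) + 1 / (1 + b) = 1 := by field_simp; ring
  rw [smul_add, smul_add, smul_neg, smul_neg, smul_smul (1 / (1 + b)) b, e1, add_add_add_comm,
    ← add_smul, e2]
  simp

lemma aux_weak {N : ℝ} (w : ℕ → X →L[ℝ] ℝ) (hw : ∀ i, ‖w i‖ ≤ N) :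
    ∃ v : X →L[ℝ] ℝ, ‖v‖ ≤ N ∧ ∀ y, Tendsto (fun i => w i y) (hyperfilter ℕ : Filter ℕ) (𝓝 (v y)) := by
  have hc := WeakDual.isCompact_closedBall (𝕜 := ℝ) (E := X) 0 N
  obtain ⟨v, hv, hlim⟩ := hc.ultrafilter_le_nhds
    ((hyperfilter ℕ).map (fun i => StrongDual.toWeakDual (w i))) (by
      rw [Filter.le_principal_iff]
      exact Filter.Eventually.of_forall (f := (hyperfilter ℕ : Filter ℕ)) (fun i => by simpa using hw i))
  refine ⟨WeakDual.toStrongDual v, by simpa using hv, fun y => ?_⟩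
  have h1 : Tendsto (fun i => StrongDual.toWeakDual (w i)) (hyperfilter ℕ : Filter ℕ) (𝓝 v) := hlim
  exact ((WeakDual.eval_continuous y).tendsto v).comp h1

lemma aux_closed {B : Set (X × (X →L[ℝ] ℝ))} (hB : IsMaxMonotoneOp B) {x : ℕ → X} {x0 : X}
    (hx : Tendsto x atTop (𝓝 x0)) {N : ℝ} (b : ℕ → X →L[ℝ] ℝ) (hb : ∀ i, (x i, b i) ∈ B)
    (hN : ∀ i, ‖b i‖ ≤ N) : ∃ b0, (x0, b0) ∈ B := by
  obtain ⟨v, -, hv⟩ := aux_weak b hN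
  refine ⟨v, aux_max_mem hB fun y ys hy => ?_⟩
  have hx' : Tendsto x (hyperfilter ℕ : Filter ℕ) (𝓝 x0) := hx.mono_left Nat.hyperfilter_le_atTop
  have h1 : Tendsto (fun i => b i (x i - x0)) (hyperfilter ℕ : Filter ℕ) (𝓝 0) := by
    apply squeeze_zero_norm (a := fun i => N * ‖x i - x0‖)
    · intro i
      exact (b i).le_of_opNorm_le (hN i) _
    · have := (tendsto_iff_norm_sub_tendsto_zero.1 hx').const_mul N
      simpa using this
  have h2 : Tendsto (fun i => b i (x i - x0) + b i (x0 - y) - ys (x i - y))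
      (hyperfilter ℕ : Filter ℕ) (𝓝 (0 + v (x0 - y) - ys (x0 - y))) :=
    (h1.add (hv _)).sub ((ys.continuous.tendsto _).comp (hx'.sub_const y))
  have h3 := ge_of_tendsto' h2 (b := 0) (fun i => by
    have := hB.1 _ (hb i) _ hy
    simp only [sub_apply, map_sub] at this ⊢
    linarith)
  simpa using h3

lemma aux_cn [CompleteSpace X] {B : Set (X × (X →L[ℝ] ℝ))} (hB : IsMaxMonotoneOp B) {x0 : X}
    (hx0 : x0 ∈ interior (convexHull ℝ (opDom B))) :
    ∃ r > 0, ∃ N : ℝ, 0 ≤ N ∧ ∀ x, ‖x - x0‖ < r → ∃ w : X →L[ℝ] ℝ, ‖w‖ ≤ N ∧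
      ∀ y ys, (y, ys) ∈ B → ys (x - y) + w y ≤ N := by
  set C : ℕ → Set X := fun n => {x | ∃ w : X →L[ℝ] ℝ, ‖w‖ ≤ n ∧
      ∀ y ys, (y, ys) ∈ B → ys (x - y) + w y ≤ n} with hC
  have hmono : Monotone C := by
    rintro n m hnm x ⟨w, hw, h⟩
    have : (n : ℝ) ≤ m := by exact_mod_cast hnm
    exact ⟨w, hw.trans this, fun y ys hy => (h y ys hy).trans this⟩
  have hcv : ∀ n, Convex ℝ (C n) := by
    rintro n x ⟨w, hw, h⟩ x' ⟨w', hw', h'⟩ a b ha hb hab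
    refine ⟨a • w + b • w', ?_, fun y ys hy => ?_⟩
    · exact mem_closedBall_zero_iff.1 ((convex_closedBall (0 : X →L[ℝ] ℝ) n)
        (mem_closedBall_zero_iff.2 hw) (mem_closedBall_zero_iff.2 hw') ha hb hab)
    · have h1 := mul_le_mul_of_nonneg_left (h y ys hy) ha
      have h2 := mul_le_mul_of_nonneg_left (h' y ys hy) hb
      have e : b = 1 - a := by linarith
      subst e
      simp only [map_sub, map_add, map_smul, smul_eq_mul, add_apply, smul_apply] at h1 h2 ⊢
      linarith
  have hcl : ∀ n, IsClosed (C n) := by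
    intro n
    apply IsSeqClosed.isClosed
    intro x x1 hx hlim
    choose w hw h using hx
    obtain ⟨v, hvn, hv⟩ := aux_weak w hw
    refine ⟨v, hvn, fun y ys hy => ?_⟩
    have hx' : Tendsto x (hyperfilter ℕ : Filter ℕ) (𝓝 x1) :=
      hlim.mono_left Nat.hyperfilter_le_atTop
    exact le_of_tendsto' (((ys.continuous.tendsto _).comp (hx'.sub_const y)).add (hv y))
      (fun i => h i y ys hy)
  have hsub : convexHull ℝ (opDom B) ⊆ ⋃ n, C n := by
    apply convexHull_min
    · rintro x ⟨xs, hx⟩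
      obtain ⟨n, hn⟩ := exists_nat_ge (max ‖xs‖ (xs x))
      refine mem_iUnion.2 ⟨n, xs, (le_max_left _ _).trans hn, fun y ys hy => ?_⟩
      have h1 := hB.1 _ hx _ hy
      have h2 := (le_max_right ‖xs‖ (xs x)).trans hn
      simp only [sub_apply, map_sub] at h1 ⊢
      linarith
    · exact Directed.convex_iUnion hmono.directed_le (fun {n} => hcv n)
  obtain ⟨n, hn⟩ := aux_baire hcl hcv hmono hsub hx0
  obtain ⟨r, hr, hball⟩ := Metric.mem_nhds_iff.1 (mem_interior_iff_mem_nhds.1 hn)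
  exact ⟨r, hr, n, by positivity, fun x hx => hball (by simpa [dist_eq_norm] using hx)⟩

lemma aux_K [CompleteSpace X] {B : Set (X × (X →L[ℝ] ℝ))} (hB : IsMaxMonotoneOp B) {x0 : X}
    (hx0 : x0 ∈ interior (convexHull ℝ (opDom B))) :
    ∃ r > 0, ∃ N : ℝ, 0 ≤ N ∧ ∀ y ys, (y, ys) ∈ B → r * ‖ys‖ ≤ ys (y - x0) + N * (1 + ‖y‖) := by
  obtain ⟨r, hr, N, hN, h⟩ := aux_cn hB hx0
  refine ⟨r / 2, by positivity, N, hN, fun y ys hy => ?_⟩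
  set K := ys (y - x0) + N * (1 + ‖y‖) with hK
  have hu : ∀ u : X, ‖u‖ < r → ys u ≤ K := by
    intro u hu
    obtain ⟨w, hw, h1⟩ := h (x0 + u) (by simpa using hu)
    have h2 := h1 y ys hy
    have h3 := w.le_of_opNorm_le hw y
    rw [Real.norm_eq_abs] at h3
    have h4 := neg_abs_le (w y)
    simp only [map_sub, map_add] at h2 hK ⊢
    linarith
  have hK0 : 0 ≤ K := by simpa using hu 0 (by simpa using hr)
  have hn : ‖ys‖ ≤ K / (r / 2) := by
    apply ContinuousLinearMap.opNorm_le_bound _ (by positivity)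
    intro v
    rcases eq_or_ne v 0 with rfl | hv
    · simp
    have hv' : 0 < ‖v‖ := norm_pos_iff.2 hv
    have hnorm : ‖(r / 2 / ‖v‖) • v‖ < r := by
      rw [norm_smul, Real.norm_of_nonneg (by positivity), div_mul_cancel₀ _ hv'.ne']
      linarith
    have h1 := hu _ hnorm
    have h2 := hu (-((r / 2 / ‖v‖) • v)) (by rwa [norm_neg])
    rw [map_neg] at h2
    rw [map_smul, smul_eq_mul] at h1 h2
    have e : |ys v| * (r / 2 / ‖v‖) ≤ K := by
      rcases abs_cases (ys v) with ⟨e, _⟩ | ⟨e, _⟩ <;> rw [e] <;> linarith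
    rw [Real.norm_eq_abs, div_mul_eq_mul_div, le_div_iff₀ (by positivity)]
    have : |ys v| * (r / 2) = |ys v| * (r / 2 / ‖v‖) * ‖v‖ := by field_simp
    rw [this]
    exact mul_le_mul_of_nonneg_right e hv'.le
  rw [le_div_iff₀ (by positivity)] at hn
  linarith

/-- The convex set used for the second operator in the duality argument. -/
def auxQ (B : Set (X × (X →L[ℝ] ℝ))) (z : X) (zs : X →L[ℝ] ℝ) : Set (X × ℝ) :=
  {p | ∃ w : X →L[ℝ] ℝ, ∀ y ys, (y, ys) ∈ B → ys (p.1 - y) + w y - w z - zs (p.1 - z) ≤ p.2}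

lemma auxQ_convex (B : Set (X × (X →L[ℝ] ℝ))) (z : X) (zs : X →L[ℝ] ℝ) :
    Convex ℝ (auxQ B z zs) := by
  rintro ⟨x, α⟩ ⟨w, h⟩ ⟨x', α'⟩ ⟨w', h'⟩ a b ha hb hab
  refine ⟨a • w + b • w', fun y ys hy => ?_⟩
  have h1 := mul_le_mul_of_nonneg_left (h y ys hy) ha
  have h2 := mul_le_mul_of_nonneg_left (h' y ys hy) hb
  have e : b = 1 - a := by linarith
  subst e
  simp only [map_sub, map_add, map_smul, smul_eq_mul, add_apply, smul_apply, Prod.fst_add,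
    Prod.smul_fst, Prod.snd_add, Prod.smul_snd] at h1 h2 ⊢
  linarith

lemma auxQ_mem {B : Set (X × (X →L[ℝ] ℝ))} (hB : IsMonotoneOp B) (z : X) (zs : X →L[ℝ] ℝ)
    {x : X} {xs : X →L[ℝ] ℝ} (hx : (x, xs) ∈ B) : (x, (xs - zs) (x - z)) ∈ auxQ B z zs := by
  refine ⟨xs, fun y ys hy => ?_⟩
  have := hB _ hx _ hy
  simp only [map_sub, sub_apply] at this ⊢
  linarith

lemma auxQ_bdd [CompleteSpace X] {B : Set (X × (X →L[ℝ] ℝ))} (hB : IsMaxMonotoneOp B) {x0 : X}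
    (hx0 : x0 ∈ interior (convexHull ℝ (opDom B))) (z : X) (zs : X →L[ℝ] ℝ) :
    ∃ r > 0, ∃ M : ℝ, ∀ u, ‖u - x0‖ < r → ∃ β ≤ M, (u, β) ∈ auxQ B z zs := by
  obtain ⟨r, hr, N, hN, h⟩ := aux_cn hB hx0
  refine ⟨r, hr, N + N * ‖z‖ + ‖zs‖ * (r + ‖x0 - z‖), fun u hu => ?_⟩
  obtain ⟨w, hw, h1⟩ := h u hu
  refine ⟨_, le_rfl, w, fun y ys hy => ?_⟩
  have h2 := h1 y ys hy
  have h3 := w.le_of_opNorm_le hw z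
  have h4 := zs.le_opNorm (u - z)
  have h5 : ‖u - z‖ ≤ r + ‖x0 - z‖ := by
    have := norm_sub_le_norm_sub_add_norm_sub u x0 z
    linarith
  have h6 := mul_le_mul_of_nonneg_left h5 (norm_nonneg zs)
  rw [Real.norm_eq_abs] at h3 h4
  have h7 := neg_abs_le (w z)
  have h8 := neg_abs_le (zs (u - z))
  simp only
  linarith

lemma aux_dom [CompleteSpace X] {B : Set (X × (X →L[ℝ] ℝ))} (hB : IsMaxMonotoneOp B) {x0 : X}
    (hx0 : x0 ∈ interior (convexHull ℝ (opDom B))) : ∃ xs, (x0, xs) ∈ B := by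
  obtain ⟨r, hr, M, hM⟩ := auxQ_bdd hB hx0 x0 0
  obtain ⟨w, hw⟩ := aux_sandwich (P := {((x0 : X), (0 : ℝ))}) (convex_singleton _)
    (auxQ_convex B x0 0) (by
      rintro x α β hp ⟨w, hw⟩
      simp only [mem_singleton_iff, Prod.mk.injEq] at hp
      obtain ⟨rfl, rfl⟩ := hp
      by_contra hneg
      push Not at hneg
      have hm : (x, w) ∈ B := aux_max_mem hB fun y ys hy => by
        have := hw y ys hy
        simp only [map_sub, sub_apply, zero_apply] at this ⊢
        linarith
      have := hw x w hm
      simp at this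
      linarith) hr rfl hM
  refine ⟨-w, aux_max_mem hB fun y ys hy => ?_⟩
  have := hw x0 0 y _ rfl (auxQ_mem hB.1 x0 0 hy)
  simp only [map_sub, sub_apply, zero_apply, neg_apply] at this ⊢
  linarith

/-- The convex set used for the linear relation in the duality argument. -/
def auxP (S : Submodule ℝ (X × (X →L[ℝ] ℝ))) (z : X) : Set (X × ℝ) :=
  {p | ∃ ys, (p.1, ys) ∈ S ∧ ys (p.1 - z) ≤ p.2}

lemma aux_nonneg {S : Submodule ℝ (X × (X →L[ℝ] ℝ))}
    (hS : IsMonotoneOp (S : Set (X × (X →L[ℝ] ℝ)))) {x : X} {xs : X →L[ℝ] ℝ} (h : (x, xs) ∈ S) :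
    0 ≤ xs x := by
  simpa using hS _ h 0 S.zero_mem

lemma auxP_convex {S : Submodule ℝ (X × (X →L[ℝ] ℝ))}
    (hS : IsMonotoneOp (S : Set (X × (X →L[ℝ] ℝ)))) (z : X) : Convex ℝ (auxP S z) := by
  rintro ⟨x, α⟩ ⟨w, hw, h⟩ ⟨x', α'⟩ ⟨w', hw', h'⟩ a b ha hb hab
  refine ⟨a • w + b • w', ?_, ?_⟩
  · exact S.add_mem (S.smul_mem a hw) (S.smul_mem b hw')
  have h1 := mul_le_mul_of_nonneg_left h ha
  have h2 := mul_le_mul_of_nonneg_left h' hb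
  have h3 := mul_nonneg (mul_nonneg ha hb) (hS _ hw _ hw')
  have e : b = 1 - a := by linarith
  subst e
  simp only [map_sub, map_add, map_smul, smul_eq_mul, add_apply, sub_apply, smul_apply, Prod.fst_add,
    Prod.smul_fst, Prod.snd_add, Prod.smul_snd] at h1 h2 h3 ⊢
  linarith

lemma aux_fpv {S : Submodule ℝ (X × (X →L[ℝ] ℝ))}
    (hS : IsMaxMonotoneOp (S : Set (X × (X →L[ℝ] ℝ)))) {z : X}
    (hz : z ∈ closure (opDom (S : Set (X × (X →L[ℝ] ℝ))))) {ρ ε : ℝ} (hρ : 0 < ρ) (hε : 0 < ε) :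
    ∃ d ds, (d, ds) ∈ S ∧ ‖d - z‖ < ρ ∧ ds (d - z) < ε := by
  by_contra hcon
  push Not at hcon
  obtain ⟨x0, ⟨x0s, hx0⟩, hd⟩ := Metric.mem_closure_iff.1 hz ρ hρ
  rw [dist_comm, dist_eq_norm] at hd
  obtain ⟨w, hw⟩ := aux_sandwich (P := auxP S z) (Q := Metric.ball z ρ ×ˢ {-ε})
    (auxP_convex hS.1 z) ((convex_ball _ _).prod (convex_singleton _)) (by
      rintro x α β ⟨ys, hy, h⟩ ⟨h1, h2⟩
      have := hcon x ys hy (by simpa [dist_eq_norm] using h1)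
      simp only [mem_singleton_iff] at h2 h
      linarith) (x0 := x0) (r := ρ - ‖x0 - z‖) (M := -ε) (α0 := x0s (x0 - z)) (by linarith) ⟨x0s, hx0, le_rfl⟩ (by
      intro u hu
      refine ⟨_, le_rfl, ?_, rfl⟩
      simp only [Metric.mem_ball, dist_eq_norm]
      have := norm_sub_le_norm_sub_add_norm_sub u x0 z
      linarith)
  have key : ∀ y ys, (y, ys) ∈ S → ε ≤ (w - ys) (z - y) := by
    intro y ys hy
    have := hw y (ys (y - z)) z (-ε) ⟨ys, hy, le_rfl⟩ ⟨by simpa using hρ, rfl⟩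
    simp only [map_sub, sub_apply] at this ⊢
    linarith
  have hm : (z, w) ∈ (S : Set (X × (X →L[ℝ] ℝ))) :=
    aux_max_mem hS fun y ys hy => hε.le.trans (key y ys hy)
  have := key z w hm
  simp at this
  linarith

lemma aux_dom_closure {S : Submodule ℝ (X × (X →L[ℝ] ℝ))}
    (hS : IsMaxMonotoneOp (S : Set (X × (X →L[ℝ] ℝ)))) {z : X}
    (hz : z ∉ closure (opDom (S : Set (X × (X →L[ℝ] ℝ))))) :
    ∃ f : X →L[ℝ] ℝ, 0 < f z ∧ ∀ c : ℝ, ((0 : X), c • f) ∈ S := by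
  have hcv : Convex ℝ (opDom (S : Set (X × (X →L[ℝ] ℝ)))) := by
    rintro x ⟨xs, hx⟩ y ⟨ys, hy⟩ a b ha hb hab
    exact ⟨a • xs + b • ys, S.add_mem (S.smul_mem a hx) (S.smul_mem b hy)⟩
  obtain ⟨f, u, h1, h2⟩ := geometric_hahn_banach_closed_point hcv.closure isClosed_closure hz
  have h0 : 0 < u := by
    simpa using h1 0 (subset_closure ⟨0, S.zero_mem⟩)
  refine ⟨f, h0.trans h2, fun c => ?_⟩
  have hz0 : ∀ a as, (a, as) ∈ S → f a = 0 := by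
    intro a as ha
    by_contra hne
    have := h1 ((u / f a) • a) (subset_closure ⟨(u / f a) • as, S.smul_mem _ ha⟩)
    rw [map_smul, smul_eq_mul, div_mul_cancel₀ _ hne] at this
    exact lt_irrefl _ this
  refine aux_max_mem hS fun y ys hy => ?_
  have h3 := hz0 y ys hy
  have h4 := aux_nonneg hS.1 hy
  simp only [map_sub, sub_apply, smul_apply, map_zero, h3, smul_zero]
  linarith

/-- The case in which the ray through `z` leaves the interior of the domain before `z`. -/
lemma aux_case2 [CompleteSpace X] {S : Submodule ℝ (X × (X →L[ℝ] ℝ))}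
    {B : Set (X × (X →L[ℝ] ℝ))} (hB : IsMaxMonotoneOp B)
    (h0 : (0 : X) ∈ interior (convexHull ℝ (opDom B))) {z : X} {zs : X →L[ℝ] ℝ}
    (hz : z ∈ closure (opDom (S : Set (X × (X →L[ℝ] ℝ)))))
    (h : ∀ x as bs, (x, as) ∈ S → (x, bs) ∈ B → 0 ≤ (zs - as - bs) (z - x))
    {t1 : ℝ} (ht1 : 0 < t1) (ht1' : t1 < 1)
    (hout : t1 • z ∉ interior (convexHull ℝ (opDom B))) : False := by
  set C := convexHull ℝ (opDom B) with hC
  have hCc : Convex ℝ C := convex_convexHull ℝ _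
  obtain ⟨r, hr, N, hN, hK⟩ := aux_K hB h0
  set t2 := (1 + t1) / 2 with ht2
  have h12 : t1 < t2 := by rw [ht2]; linarith
  have h21 : t2 < 1 := by rw [ht2]; linarith
  have ht2pos : 0 < t2 := ht1.trans h12
  have hncl : t2 • z ∉ closure C := by
    intro hcl
    apply hout
    have := hCc.combo_interior_closure_mem_interior h0 hcl (a := 1 - t1 / t2) (b := t1 / t2)
      (by rw [sub_pos, div_lt_one ht2pos]; exact h12) (by positivity) (by ring)
    rwa [smul_zero, zero_add, smul_smul, div_mul_cancel₀ _ ht2pos.ne'] at this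
  have hopen : IsOpen {d : X | t2 • d ∉ closure C} :=
    (isClosed_closure.isOpen_compl).preimage (by fun_prop : Continuous fun d : X => t2 • d)
  obtain ⟨ρ0, hρ0, hball⟩ := Metric.isOpen_iff.1 hopen z hncl
  set ρ := min ρ0 (r * (1 - t2) / 2) with hρ
  have hρpos : 0 < ρ := lt_min hρ0 (by have : 0 < 1 - t2 := by linarith
                                       positivity)
  obtain ⟨d, ⟨ds, hd⟩, hdz⟩ := Metric.mem_closure_iff.1 hz ρ hρpos
  have hd' : t2 • d ∉ closure C := hball (by
    rw [Metric.mem_ball, dist_comm]; exact hdz.trans_le (min_le_left _ _))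
  rw [dist_eq_norm] at hdz
  have hρr : ‖z - d‖ ≤ r * (1 - t2) / 2 := hdz.le.trans (min_le_right _ _)
  -- uniform bound
  obtain ⟨K, hKb⟩ : ∃ K : ℝ, ∀ t bs, 0 ≤ t → t ≤ t2 → (t • d, bs) ∈ B → ‖bs‖ ≤ K := by
    set K1 := (‖zs‖ + ‖ds‖) * (‖z‖ + ‖d‖) with hK1
    have hK1n : 0 ≤ K1 := by positivity
    refine ⟨(K1 / (1 - t2) + N * (1 + ‖d‖)) / (r / 2), fun t bs ht htt hb => ?_⟩
    have hA := h (t • d) (t • ds) bs (S.smul_mem t hd) hb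
    have hk := hK _ _ hb
    have e1 : ‖z - t • d‖ ≤ ‖z‖ + ‖d‖ := by
      refine (norm_sub_le _ _).trans ?_
      rw [norm_smul, Real.norm_of_nonneg ht]
      have : t * ‖d‖ ≤ 1 * ‖d‖ := mul_le_mul_of_nonneg_right (by linarith) (norm_nonneg _)
      linarith
    have e2 : ‖zs - t • ds‖ ≤ ‖zs‖ + ‖ds‖ := by
      refine (norm_sub_le _ _).trans ?_
      rw [norm_smul, Real.norm_of_nonneg ht]
      have : t * ‖ds‖ ≤ 1 * ‖ds‖ := mul_le_mul_of_nonneg_right (by linarith) (norm_nonneg _)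
      linarith
    have e3 : (zs - t • ds) (z - t • d) ≤ K1 :=
      (le_abs_self _).trans (((zs - t • ds).le_opNorm _).trans
        (mul_le_mul e2 e1 (norm_nonneg _) (by positivity)))
    have e4 : -bs (z - d) ≤ ‖bs‖ * (r * (1 - t2) / 2) :=
      (neg_le_abs _).trans ((bs.le_opNorm _).trans
        (mul_le_mul_of_nonneg_left hρr (norm_nonneg _)))
    have e5 : (1 - t) * bs d ≤ K1 + ‖bs‖ * (r * (1 - t2) / 2) := by
      have : (zs - t • ds - bs) (z - t • d)
          = (zs - t • ds) (z - t • d) - bs (z - d) - (1 - t) * bs d := by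
        simp only [sub_apply, map_sub, map_smul, smul_eq_mul]; ring
      linarith
    have h1t : 0 < 1 - t2 := by linarith
    have e6 : t * bs d ≤ K1 / (1 - t2) + ‖bs‖ * (r / 2) := by
      have hR : 0 ≤ K1 / (1 - t2) + ‖bs‖ * (r / 2) := by positivity
      rcases le_or_gt (bs d) 0 with hneg | hpos
      · exact (mul_nonpos_of_nonneg_of_nonpos ht hneg).trans hR
      · have e7 : (1 - t2) * bs d ≤ (1 - t2) * (K1 / (1 - t2) + ‖bs‖ * (r / 2)) := by
          have : (1 - t2) * (K1 / (1 - t2) + ‖bs‖ * (r / 2))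
            = K1 + ‖bs‖ * (r * (1 - t2) / 2) := by field_simp
          rw [this]
          exact (mul_le_mul_of_nonneg_right (by linarith) hpos.le).trans e5
        have e8 := le_of_mul_le_mul_left e7 h1t
        exact (mul_le_of_le_one_left hpos.le (by linarith)).trans e8
    have e9 : N * (1 + ‖t • d‖) ≤ N * (1 + ‖d‖) := by
      rw [norm_smul, Real.norm_of_nonneg ht]
      have : t * ‖d‖ ≤ 1 * ‖d‖ := mul_le_mul_of_nonneg_right (by linarith) (norm_nonneg _)
      exact mul_le_mul_of_nonneg_left (by linarith) hN
    rw [le_div_iff₀ (by positivity)]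
    rw [sub_zero, map_smul, smul_eq_mul] at hk
    linarith
  -- exit time
  have hcomp : IsCompact (Icc 0 t2 ∩ {t : ℝ | t • d ∉ interior C}) :=
    isCompact_Icc.inter_right ((isOpen_interior.isClosed_compl).preimage
      (by fun_prop : Continuous fun t : ℝ => t • d))
  obtain ⟨τ, ⟨⟨hτ0, hτ2⟩, hτout⟩, hτmin⟩ := hcomp.exists_isLeast
    ⟨t2, ⟨ht2pos.le, le_rfl⟩, fun hh => hd' (subset_closure (interior_subset hh))⟩
  have hτpos : 0 < τ := by
    rcases hτ0.eq_or_lt with h' | h'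
    · exfalso; apply hτout; rw [← h', zero_smul]; exact h0
    · exact h'
  have hin : ∀ t, 0 ≤ t → t < τ → t • d ∈ interior C := by
    intro t ht htτ
    by_contra hn
    exact absurd (hτmin ⟨⟨ht, htτ.le.trans hτ2⟩, hn⟩) (not_le.2 htτ)
  set s : ℕ → ℝ := fun k => τ * (1 - 1 / ((k : ℝ) + 1)) with hs
  have hsb : ∀ k, 0 ≤ s k ∧ s k < τ := by
    intro k
    have h1 : 0 < 1 / ((k : ℝ) + 1) := by positivity
    have h2 : 1 / ((k : ℝ) + 1) ≤ 1 := by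
      rw [div_le_one (by positivity)]; linarith [(Nat.cast_nonneg k : (0 : ℝ) ≤ k)]
    exact ⟨mul_nonneg hτ0 (by linarith), by simp only [hs]; nlinarith⟩
  have hslim : Tendsto s atTop (𝓝 τ) := by
    simpa [hs] using ((tendsto_one_div_add_atTop_nhds_zero_nat (𝕜 := ℝ)).const_sub 1).const_mul τ
  choose b hb using fun k => aux_dom hB (hin (s k) (hsb k).1 (hsb k).2)
  obtain ⟨b0, hb0⟩ := aux_closed hB (hslim.smul_const d) b hb
    (fun k => hKb _ _ (hsb k).1 ((hsb k).2.le.trans hτ2) (hb k))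
  obtain ⟨f, hf0, hf⟩ := geometric_hahn_banach_of_nonempty_interior_point hCc hτout ⟨_, h0⟩
  have hunb : ∀ c : ℝ, 0 ≤ c → (τ • d, b0 + c • f) ∈ B := by
    intro c hc
    refine aux_max_mem hB fun y ys hy => ?_
    have h1 := hB.1 _ hb0 _ hy
    have h2 := mul_nonneg hc (sub_nonneg.2 (hf y (subset_convexHull ℝ _ ⟨ys, hy⟩)))
    simp only [sub_apply, map_sub, add_apply, smul_apply, smul_eq_mul] at h1 h2 ⊢
    linarith
  have hfp : 0 < ‖f‖ := norm_pos_iff.2 hf0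
  have hb1 := hKb τ b0 hτ0 hτ2 hb0
  have hKn : 0 ≤ K := (norm_nonneg _).trans hb1
  set c := (2 * K + 1) / ‖f‖ with hc
  have hcn : 0 ≤ c := by positivity
  have hb2 := hKb τ _ hτ0 hτ2 (hunb c hcn)
  have h5 : ‖c • f‖ ≤ ‖b0 + c • f‖ + ‖b0‖ := by
    have := norm_sub_le (b0 + c • f) b0
    rwa [add_sub_cancel_left] at this
  rw [norm_smul, Real.norm_of_nonneg hcn, hc, div_mul_cancel₀ _ hfp.ne'] at h5
  linarith

lemma aux_strict [CompleteSpace X] {S : Submodule ℝ (X × (X →L[ℝ] ℝ))}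
    (hS : IsMaxMonotoneOp (S : Set (X × (X →L[ℝ] ℝ))))
    {B : Set (X × (X →L[ℝ] ℝ))} (hB : IsMaxMonotoneOp B) (h00 : ((0 : X), (0 : X →L[ℝ] ℝ)) ∈ B)
    (h0 : (0 : X) ∈ interior (convexHull ℝ (opDom B))) {z : X} {zs : X →L[ℝ] ℝ}
    {δ : ℝ} (hδ : 0 < δ)
    (h : ∀ x as bs, (x, as) ∈ S → (x, bs) ∈ B → δ ≤ (zs - as - bs) (z - x)) : False := by
  by_cases hz : z ∈ closure (opDom (S : Set (X × (X →L[ℝ] ℝ))))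
  swap
  · obtain ⟨f, hfz, hf⟩ := aux_dom_closure hS hz
    have := h 0 _ 0 (hf (zs z / f z)) h00
    simp only [sub_apply, smul_apply, sub_zero, smul_eq_mul] at this
    rw [div_mul_cancel₀ _ hfz.ne'] at this
    linarith
  by_cases hcase : ∀ t : ℝ, 0 < t → t < 1 → t • z ∈ interior (convexHull ℝ (opDom B))
  swap
  · push Not at hcase
    obtain ⟨t1, h1, h2, h3⟩ := hcase
    exact aux_case2 hB h0 hz (fun x as bs ha hb => hδ.le.trans (h x as bs ha hb)) h1 h2 h3
  -- choose t
  obtain ⟨t, ht0, ht1, ht⟩ : ∃ t : ℝ, 0 < t ∧ t < 1 ∧ (1 - t) * (‖z‖ * ‖zs‖) ≤ δ / 4 := by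
    have hlim : Tendsto (fun t : ℝ => (1 - t) * (‖z‖ * ‖zs‖)) (𝓝[<] 1) (𝓝 0) := by
      have : Tendsto (fun t : ℝ => (1 - t) * (‖z‖ * ‖zs‖)) (𝓝 1) (𝓝 ((1 - 1) * (‖z‖ * ‖zs‖))) :=
        Continuous.tendsto (by fun_prop) 1
      simpa using this.mono_left nhdsWithin_le_nhds
    obtain ⟨t, hta, htb⟩ := ((hlim.eventually (ge_mem_nhds (by positivity : 0 < δ / 4))).and
      (Ioo_mem_nhdsLT (zero_lt_one (α := ℝ)))).exists
    exact ⟨t, htb.1, htb.2, hta⟩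
  have htz := hcase t ht0 ht1
  obtain ⟨r, hr, N, hN, hK⟩ := aux_K hB htz
  obtain ⟨ρ0, hρ0, hball⟩ := Metric.isOpen_iff.1 isOpen_interior _ htz
  set M := N * (1 + (‖t • z‖ + r / 2)) / (r / 2) with hM
  have hMn : 0 ≤ M := by positivity
  set ρ := min (min ρ0 (r / 2)) (δ / 4 / (M + ‖zs‖ + 1)) with hρ
  have hρpos : 0 < ρ := lt_min (lt_min hρ0 (by positivity)) (by positivity)
  obtain ⟨d, ds, hd, hdz, hde⟩ := aux_fpv hS hz hρpos (by positivity : 0 < δ / 4)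
  have hdist : ‖t • d - t • z‖ < ρ := by
    rw [← smul_sub, norm_smul, Real.norm_of_nonneg ht0.le]
    exact (mul_le_of_le_one_left (norm_nonneg _) ht1.le).trans_lt hdz
  have htd : t • d ∈ interior (convexHull ℝ (opDom B)) := hball (by
    rw [Metric.mem_ball, dist_eq_norm]
    exact hdist.trans_le ((min_le_left _ _).trans (min_le_left _ _)))
  have hdr : ‖t • d - t • z‖ ≤ r / 2 := hdist.le.trans ((min_le_left _ _).trans (min_le_right _ _))
  obtain ⟨bs, hb⟩ := aux_dom hB htd
  have hbM : ‖bs‖ ≤ M := by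
    have h1 := hK _ _ hb
    have h2 : bs (t • d - t • z) ≤ ‖bs‖ * (r / 2) :=
      (le_abs_self _).trans ((bs.le_opNorm _).trans (mul_le_mul_of_nonneg_left hdr (norm_nonneg _)))
    have h3 : ‖t • d‖ ≤ ‖t • z‖ + r / 2 := by
      have := norm_le_norm_add_norm_sub (t • z) (t • d)
      rw [norm_sub_rev] at this
      linarith [norm_sub_rev (t • d) (t • z)]
    have h4 : N * (1 + ‖t • d‖) ≤ N * (1 + (‖t • z‖ + r / 2)) :=
      mul_le_mul_of_nonneg_left (by linarith) hN
    rw [hM, le_div_iff₀ (by positivity)]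
    linarith
  have hmain := h (t • d) (t • ds) bs (S.smul_mem t hd) hb
  have hbd : 0 ≤ bs d := by
    have := hB.1 _ hb _ h00
    simp only [sub_zero, map_smul, smul_eq_mul] at this
    exact nonneg_of_mul_nonneg_right this ht0
  have hdd := aux_nonneg hS.1 hd
  have e1 : bs (d - z) ≤ M * ρ :=
    (le_abs_self _).trans ((bs.le_opNorm _).trans (mul_le_mul hbM hdz.le (norm_nonneg _) hMn))
  have e2 : -(t * zs (d - z)) ≤ ‖zs‖ * ρ := by
    have h1 : |zs (d - z)| ≤ ‖zs‖ * ρ :=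
      (zs.le_opNorm _).trans (mul_le_mul_of_nonneg_left hdz.le (norm_nonneg _))
    have h2 : t * |zs (d - z)| ≤ |zs (d - z)| := mul_le_of_le_one_left (abs_nonneg _) ht1.le
    have h3 := mul_le_mul_of_nonneg_left (neg_le_abs (zs (d - z))) ht0.le
    linarith
  have e3 : (1 - t) * zs z ≤ δ / 4 := by
    have h1 : zs z ≤ ‖z‖ * ‖zs‖ := by
      rw [mul_comm]; exact (le_abs_self _).trans (zs.le_opNorm _)
    exact (mul_le_mul_of_nonneg_left h1 (by linarith)).trans ht
  have e4 : t * ds (d - z) ≤ δ / 4 := by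
    rcases le_or_gt (ds (d - z)) 0 with hn | hp
    · have := mul_nonpos_of_nonneg_of_nonpos ht0.le hn
      linarith
    · exact (mul_le_of_le_one_left hp.le ht1.le).trans hde.le
  have e5 : (M + ‖zs‖ + 1) * ρ ≤ δ / 4 := by
    have := mul_le_mul_of_nonneg_left (min_le_right (min ρ0 (r / 2)) (δ / 4 / (M + ‖zs‖ + 1)))
      (by positivity : 0 ≤ M + ‖zs‖ + 1)
    rwa [mul_div_cancel₀ _ (by positivity : M + ‖zs‖ + 1 ≠ 0)] at this
  have e6 : (zs - t • ds - bs) (z - t • d) = (1 - t) * zs z - t * zs (d - z) + t * ds (d - z)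
      - t * ((1 - t) * ds d) - (1 - t) * bs d + bs (d - z) := by
    simp only [sub_apply, map_sub, map_smul, smul_apply, smul_eq_mul]; ring
  have e7 : 0 ≤ t * ((1 - t) * ds d) := mul_nonneg ht0.le (mul_nonneg (by linarith) hdd)
  have e8 : 0 ≤ (1 - t) * bs d := mul_nonneg (by linarith) hbd
  rw [e6] at hmain
  linarith

lemma aux_core [CompleteSpace X] {S : Submodule ℝ (X × (X →L[ℝ] ℝ))}
    (hS : IsMaxMonotoneOp (S : Set (X × (X →L[ℝ] ℝ))))
    {B : Set (X × (X →L[ℝ] ℝ))} (hB : IsMaxMonotoneOp B) (h00 : ((0 : X), (0 : X →L[ℝ] ℝ)) ∈ B)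
    (h0 : (0 : X) ∈ interior (convexHull ℝ (opDom B))) {z : X} {zs : X →L[ℝ] ℝ}
    (h : ∀ x as bs, (x, as) ∈ S → (x, bs) ∈ B → 0 ≤ (zs - as - bs) (z - x)) :
    ∃ as bs, (z, as) ∈ S ∧ (z, bs) ∈ B ∧ zs = as + bs := by
  obtain ⟨r, hr, M, hM⟩ := auxQ_bdd hB h0 z zs
  obtain ⟨v, hv⟩ := aux_sandwich (auxP_convex hS.1 z) (auxQ_convex B z zs) (by
    rintro x α β ⟨ys, hy, hα⟩ ⟨w, hw⟩
    simp only at hα hw hy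
    by_contra hneg
    push Not at hneg
    set η := -(α + β) with hη
    have hηp : 0 < η := by rw [hη]; linarith
    set q := (ys + w - zs) (x - z) with hq
    -- choose l small with l * |q| < η
    set l := min (1 / 2) (η / 2 / (|q| + 1)) with hl
    have hlp : 0 < l := lt_min (by norm_num) (by positivity)
    have hl1 : l < 1 := (min_le_left _ _).trans_lt (by norm_num)
    have hlq : l * -q ≤ η / 2 := by
      have h1 : l * (|q| + 1) ≤ η / 2 := by
        have := mul_le_mul_of_nonneg_right (min_le_right (1 / 2) (η / 2 / (|q| + 1)))
          (by positivity : 0 ≤ |q| + 1)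
        rwa [div_mul_cancel₀ _ (by positivity : |q| + 1 ≠ 0)] at this
      have h2 := mul_le_mul_of_nonneg_left (neg_le_abs q) hlp.le
      linarith
    refine aux_strict hS hB h00 h0 (z := z + l • (x - z)) (zs := zs + l • (ys + w - zs))
      (δ := l * (η / 2)) (by positivity) ?_
    intro a as bs ha hb
    have h1 := mul_nonneg (by linarith : 0 ≤ 1 - l) (h a as bs ha hb)
    have h2 := mul_nonneg hlp.le (hS.1 _ hy _ ha)
    have h3 := mul_le_mul_of_nonneg_left (hw a bs hb) hlp.le
    have h4 := mul_le_mul_of_nonneg_left hα hlp.le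
    have h5 := mul_le_mul_of_nonneg_left hlq hlp.le
    rw [hη] at h5 ⊢
    rw [hq] at h5
    simp only [sub_apply, add_apply, smul_apply, map_sub, map_add, map_smul, smul_eq_mul]
      at h1 h2 h3 h4 h5 ⊢
    nlinarith) hr (x0 := 0) (α0 := 0) ⟨0, S.zero_mem, by simp⟩ hM
  have key : ∀ x xs u us, (x, xs) ∈ S → (u, us) ∈ B →
      0 ≤ (v - xs) (z - x) + (zs - v - us) (z - u) := by
    intro x xs u us hx hu
    have := hv x (xs (x - z)) u _ ⟨xs, hx, le_rfl⟩ (auxQ_mem hB.1 z zs hu)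
    simp only [sub_apply, map_sub] at this ⊢
    linarith
  have hAz : (z, v) ∈ S := by
    by_contra hn
    have hex : ∃ x xs, (x, xs) ∈ S ∧ (v - xs) (z - x) < 0 := by
      by_contra hc
      push Not at hc
      exact hn (aux_max_mem (A := (S : Set (X × (X →L[ℝ] ℝ)))) hS hc)
    obtain ⟨x, xs, hx, hneg⟩ := hex
    have hm : (z, zs - v) ∈ B := aux_max_mem hB fun y ys hy => by
      linarith [key x xs y ys hx hy]
    have := key x xs z _ hx hm
    simp at this hneg
    linarith
  refine ⟨v, zs - v, hAz, aux_max_mem hB fun y ys hy => ?_, by abel⟩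
  simpa using key z v y ys hAz hy

lemma aux_max_of {C : Set (X × (X →L[ℝ] ℝ))} (hm : IsMonotoneOp C)
    (h : ∀ z zs, (∀ q ∈ C, 0 ≤ (zs - q.2) (z - q.1)) → (z, zs) ∈ C) : IsMaxMonotoneOp C := by
  refine ⟨hm, fun D hD hCD => Subset.antisymm (fun p hp => ?_) hCD⟩
  exact h p.1 p.2 fun q hq => hD p hp q (hCD hq)

/-- sum theorem for a maximally monotone linear relation. -/
theorem sum_theorem_linear_relation {X : Type*} [NormedAddCommGroup X] [NormedSpace ℝ X]
    [CompleteSpace X]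
    (A B : Set (X × (X →L[ℝ] ℝ)))
    (hA : IsMaxMonotoneOp A) (hB : IsMaxMonotoneOp B)
    (hlin : ∃ S : Submodule ℝ (X × (X →L[ℝ] ℝ)), (S : Set (X × (X →L[ℝ] ℝ))) = A)
    (hdom : (opDom A ∩ interior (opDom B)).Nonempty) :
    IsMaxMonotoneOp (opSum A B) := by
  obtain ⟨S, rfl⟩ := hlin
  obtain ⟨x0, ⟨a0, ha0⟩, hx0⟩ := hdom
  obtain ⟨b0, hb0⟩ := interior_subset hx0
  set B' : Set (X × (X →L[ℝ] ℝ)) := {p | (p.1 + x0, p.2 + b0) ∈ B} with hB'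
  have hmax' : IsMaxMonotoneOp B' := by
    apply aux_max_of
    · intro p hp q hq
      simpa using hB.1 _ hp _ hq
    · intro z zs h
      refine aux_max_mem hB fun y ys hy => ?_
      have := h (y - x0, ys - b0) (by simpa [hB'] using hy)
      simp only [sub_apply, add_apply, map_sub, map_add] at this ⊢
      linarith
  have h0 : (0 : X) ∈ interior (convexHull ℝ (opDom B')) := by
    apply interior_mono (subset_convexHull ℝ _)
    have hdomeq : (fun x : X => x + x0) ⁻¹' interior (opDom B) ⊆ interior (opDom B') := by
      apply interior_maximal _ (isOpen_interior.preimage (by fun_prop))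
      intro x hx
      obtain ⟨xs, hxs⟩ := interior_subset (show x + x0 ∈ interior (opDom B) from hx)
      exact ⟨xs - b0, by simpa [hB'] using hxs⟩
    exact hdomeq (by simpa using hx0)
  apply aux_max_of
  · rintro ⟨x, p⟩ ⟨as, bs, ha, hb, e⟩ ⟨y, q⟩ ⟨as', bs', ha', hb', e'⟩
    have h1 := hA.1 _ ha _ ha'
    have h2 := hB.1 _ hb _ hb'
    simp only at e e'
    subst e e'
    simp only [sub_apply, add_apply, map_sub, map_add] at h1 h2 ⊢
    linarith
  · intro z zs h
    obtain ⟨as, bs, ha, hb, e⟩ := aux_core hA hmax' (by simpa [hB'] using hb0) h0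
      (z := z - x0) (zs := zs - a0 - b0) (by
        intro x as bs ha hb
        have := h (x + x0, (as + a0) + (bs + b0))
          ⟨as + a0, bs + b0, S.add_mem ha ha0, hb, rfl⟩
        simp only [sub_apply, add_apply, map_sub, map_add] at this ⊢
        linarith)
    refine ⟨as + a0, bs + b0, ?_, ?_, ?_⟩
    · simpa using S.add_mem ha ha0
    · simpa [hB'] using hb
    · simp only
      have : zs = (zs - a0 - b0) + a0 + b0 := by abel
      rw [this, e]; abel
end
end

section
/- Let X be a real Banach space and let A, B : X ⇉ X* be maximally monotone operators with dom A ∩ int(dom B) ≠ ∅. Assume that A is of type (FPV) and that dom A is a convex set. Then A + B is of type (FPV). -/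
open Set Filter Topology

noncomputable section

variable {X : Type*} [NormedAddCommGroup X] [NormedSpace ℝ X]

theorem mono_exp {B : Set (X × (X →L[ℝ] ℝ))} (hB : IsMonotoneOp B) {x y : X}
    {xs ys : X →L[ℝ] ℝ} (hx : (x, xs) ∈ B) (hy : (y, ys) ∈ B) :
    0 ≤ xs x - xs y - ys x + ys y := by
  have := hB _ hx _ hy
  simp only [sub_apply, map_sub] at this
  linarith

theorem max_mem {B : Set (X × (X →L[ℝ] ℝ))} (hB : IsMaxMonotoneOp B) {x : X}
    {xs : X →L[ℝ] ℝ} (h : ∀ c cs, (c, cs) ∈ B → 0 ≤ xs x - xs c - cs x + cs c) :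
    (x, xs) ∈ B := by
  have hm : IsMonotoneOp (insert (x, xs) B) := by
    rintro ⟨p, ps⟩ hp ⟨q, qs⟩ hq
    simp only [sub_apply, map_sub]
    rcases hp with hp | hp <;> rcases hq with hq | hq
    · simp only [Prod.mk.injEq] at hp hq
      rw [hp.1, hp.2, hq.1, hq.2]; simp
    · simp only [Prod.mk.injEq] at hp
      have := h _ _ hq
      rw [hp.1, hp.2]; linarith
    · simp only [Prod.mk.injEq] at hq
      have := h _ _ hp
      rw [hq.1, hq.2]; linarith
    · have := mono_exp hB.1 hp hq
      linarith
  rw [← hB.2 _ hm (subset_insert _ _)]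
  exact mem_insert _ _

theorem norm_le_of_unit {f : X →L[ℝ] ℝ} {C : ℝ} (hC : 0 ≤ C) (h : ∀ u, ‖u‖ ≤ 1 → f u ≤ C) :
    ‖f‖ ≤ C := by
  refine ContinuousLinearMap.opNorm_le_of_unit_norm hC ?_
  intro u hu
  rw [Real.norm_eq_abs, abs_le]
  have h1 := h u hu.le
  have h2 := h (-u) (by rw [norm_neg]; exact hu.le)
  rw [map_neg] at h2
  constructor <;> linarith

theorem apply_le_of {f : X →L[ℝ] ℝ} {M : ℝ} (h : ‖f‖ ≤ M) (x : X) : |f x| ≤ M * ‖x‖ := by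
  have := f.le_opNorm x
  rw [Real.norm_eq_abs] at this
  exact this.trans (by gcongr)

/-- Local boundedness at interior points of the domain. -/
theorem loc_bdd [CompleteSpace X] {B : Set (X × (X →L[ℝ] ℝ))} (hB : IsMonotoneOp B) {q : X}
    (hq : q ∈ interior (opDom B)) :
    ∃ δ > 0, ∃ M ≥ 0, Metric.ball q δ ⊆ interior (opDom B) ∧
      ∀ c cs, (c, cs) ∈ B → ‖c - q‖ < δ → ‖cs‖ ≤ M := by
  obtain ⟨r, hr, hball⟩ := Metric.isOpen_iff.1 isOpen_interior q hq
  let F : ℕ → Set X := fun n => {x | ∀ c cs, (c, cs) ∈ B → ‖c - q‖ ≤ 1 → cs (x - c) ≤ n}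
  have hFc : ∀ n, IsClosed (F n) := by
    intro n
    have : F n = ⋂ c, ⋂ cs, ⋂ (_ : (c, cs) ∈ B), ⋂ (_ : ‖c - q‖ ≤ 1),
        {x | cs (x - c) ≤ n} := by
      ext x; simp [F]
    rw [this]
    refine isClosed_iInter fun c => isClosed_iInter fun cs => isClosed_iInter fun _ =>
      isClosed_iInter fun _ => isClosed_le (by fun_prop) continuous_const
  have hcov : ∀ x ∈ Metric.ball q r, ∃ n, x ∈ F n := by
    intro x hx
    obtain ⟨xs, hxs⟩ := interior_subset (hball hx)
    obtain ⟨n, hn⟩ := exists_nat_ge (‖xs‖ * (‖x - q‖ + 1))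
    refine ⟨n, fun c cs hc hcq => ?_⟩
    have h1 := mono_exp hB hxs hc
    have h2 := (abs_le.1 (apply_le_of (le_refl ‖xs‖) (x - c))).2
    have h3 : ‖x - c‖ ≤ ‖x - q‖ + 1 := by
      have := norm_sub_le (x - q) (c - q)
      rw [sub_sub_sub_cancel_right] at this
      linarith
    have h4 : ‖xs‖ * ‖x - c‖ ≤ ‖xs‖ * (‖x - q‖ + 1) := by gcongr
    rw [map_sub] at h2 ⊢
    linarith
  have hd := dense_iUnion_interior_of_closed (f := fun n => F n ∪ (Metric.ball q r)ᶜ)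
    (fun n => (hFc n).union Metric.isOpen_ball.isClosed_compl) (by
      rw [eq_univ_iff_forall]
      intro x
      rw [mem_iUnion]
      by_cases hx : x ∈ Metric.ball q r
      · obtain ⟨n, hn⟩ := hcov x hx
        exact ⟨n, Or.inl hn⟩
      · exact ⟨0, Or.inr hx⟩)
  obtain ⟨x1, hx1, hx1'⟩ := hd.exists_mem_open Metric.isOpen_ball ⟨q, Metric.mem_ball_self hr⟩
  rw [mem_iUnion] at hx1
  obtain ⟨n, hn⟩ := hx1
  obtain ⟨ρ, hρ, hρ'⟩ := Metric.isOpen_iff.1 (isOpen_interior.inter Metric.isOpen_ball) x1 ⟨hn, hx1'⟩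
  have hFn : Metric.ball x1 ρ ⊆ F n := by
    intro y hy
    have h1 := hρ' hy
    rcases interior_subset h1.1 with h | h
    · exact h
    · exact absurd h1.2 h
  obtain ⟨m, hm⟩ := hcov (q - (x1 - q)) (by
    rw [mem_ball_iff_norm] at hx1' ⊢
    rw [show q - (x1 - q) - q = -(x1 - q) by abel, norm_neg]; exact hx1')
  have hK : ∀ y, ‖y - q‖ < ρ / 2 → ∀ c cs, (c, cs) ∈ B → ‖c - q‖ ≤ 1 →
      cs (y - c) ≤ ((n : ℝ) + m) / 2 := by
    intro y hy c cs hc hcq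
    have hmem : x1 + (2 : ℝ) • (y - q) ∈ Metric.ball x1 ρ := by
      rw [mem_ball_iff_norm, add_sub_cancel_left, norm_smul, Real.norm_ofNat]
      linarith
    have h1 := hFn hmem c cs hc hcq
    have h2 := hm c cs hc hcq
    simp only [map_sub, map_add, map_smul, smul_eq_mul] at h1 h2 ⊢
    linarith
  refine ⟨min (min (ρ / 4) 1) r, by positivity, 4 * (((n : ℝ) + m) / 2) / ρ, by positivity,
    (Metric.ball_subset_ball (min_le_right _ _)).trans hball, ?_⟩
  intro c cs hc hcq
  rw [lt_min_iff, lt_min_iff] at hcq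
  refine norm_le_of_unit (by positivity) fun u hu => ?_
  have h1 := hK (c + (ρ / 4) • u) (by
    have := norm_add_le (c - q) ((ρ / 4) • u)
    rw [norm_smul, Real.norm_of_nonneg (by positivity : 0 ≤ ρ / 4)] at this
    rw [show c + (ρ / 4) • u - q = c - q + (ρ / 4) • u by abel]
    nlinarith [hcq.1.1]) c cs hc hcq.1.2.le
  rw [add_sub_cancel_left, map_smul, smul_eq_mul] at h1
  rw [le_div_iff₀ hρ]
  linarith

/-- Hahn-Banach in the form we use. -/
theorem hb_lemma {S : Set (X × ℝ)} (hS : Convex ℝ S) (h0 : ∀ r, ((0 : X), r) ∈ S → 0 ≤ r)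
    {δ R : ℝ} (hδ : 0 < δ) (hR : ∀ d : X, ‖d‖ < δ → ∃ r ≤ R, (d, r) ∈ S) :
    ∃ b : X →L[ℝ] ℝ, ∀ d r, (d, r) ∈ S → 0 ≤ r + b d := by
  let E : Set (X × ℝ) := {p | ∃ r ≤ p.2, (p.1, r) ∈ S}
  have hE : Convex ℝ E := by
    rintro ⟨x, a⟩ ⟨r, hr, hx⟩ ⟨y, b⟩ ⟨s, hs, hy⟩ α β hα hβ hαβ
    refine ⟨α * r + β * s, ?_, ?_⟩
    · simp only [Prod.smul_mk, Prod.mk_add_mk, smul_eq_mul] at hr hs ⊢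
      gcongr
    · have := hS hx hy hα hβ hαβ
      simpa using this
  have hsub : Metric.ball (0 : X) δ ×ˢ Ioi R ⊆ E := by
    rintro ⟨d, r⟩ ⟨hd, hr⟩
    obtain ⟨r', hr', hm⟩ := hR d (by simpa using hd)
    exact ⟨r', hr'.trans (le_of_lt hr), hm⟩
  have hball_sub : Metric.ball (0 : X) δ ×ˢ Ioi R ⊆ interior E :=
    interior_maximal hsub (Metric.isOpen_ball.prod isOpen_Ioi)
  have hne : ((0 : X), max R 0 + 1) ∈ interior E :=
    hball_sub ⟨by simpa using hδ, by simp only [mem_Ioi]; linarith [le_max_left R 0]⟩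
  have hnot : ((0 : X), (0 : ℝ)) ∉ interior E := by
    intro h
    have hc : Tendsto (fun t : ℝ => ((0 : X), t)) (𝓝 0) (𝓝 ((0 : X), (0 : ℝ))) :=
      (Continuous.prodMk continuous_const continuous_id).tendsto 0
    have h1 := hc.eventually (isOpen_interior.mem_nhds h)
    obtain ⟨ε, hε, h2⟩ := Metric.eventually_nhds_iff.1 h1
    obtain ⟨r, hr, hm⟩ := interior_subset (h2 (y := -(ε / 2)) (by
      rw [dist_zero_right, norm_neg, Real.norm_of_nonneg (by positivity)]; linarith))
    have := h0 r hm
    simp only at hr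
    linarith
  obtain ⟨f, hf⟩ := geometric_hahn_banach_open_point hE.interior isOpen_interior hnot
  have hz : f ((0 : X), (0 : ℝ)) = 0 := f.map_zero
  rw [hz] at hf
  have hsplit : ∀ d r, f (d, r) = f (d, 0) + r * f (0, 1) := by
    intro d r
    have : ((d, r) : X × ℝ) = (d, 0) + r • ((0 : X), (1 : ℝ)) := by simp
    rw [this, map_add, map_smul, smul_eq_mul]
  have hm : f ((0 : X), (1 : ℝ)) < 0 := by
    have := hf _ hne
    rw [hsplit, hz, zero_add] at this
    have h3 : 0 < max R 0 + 1 := by linarith [le_max_right R 0]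
    by_contra hcon
    push Not at hcon
    have := mul_nonneg h3.le hcon
    linarith
  have hfE : ∀ p ∈ E, f p ≤ 0 := by
    intro p hp
    have hcl : p ∈ closure (interior E) := by
      rw [hE.closure_interior_eq_closure_of_nonempty_interior ⟨_, hne⟩]
      exact subset_closure hp
    exact closure_minimal (t := {p | f p ≤ 0}) (fun p hp => (hf p hp).le)
      (isClosed_le f.continuous continuous_const) hcl
  refine ⟨(f ((0 : X), (1 : ℝ)))⁻¹ • (f.comp (ContinuousLinearMap.inl ℝ X ℝ)), ?_⟩
  intro d r hdr
  have h1 := hfE (d, r) ⟨r, le_refl _, hdr⟩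
  rw [hsplit] at h1
  simp only [smul_apply, ContinuousLinearMap.comp_apply,
    ContinuousLinearMap.inl_apply, smul_eq_mul]
  have h2 : r + (f ((0 : X), (1 : ℝ)))⁻¹ * f (d, 0) =
      (f ((0 : X), (1 : ℝ)))⁻¹ * (f (d, 0) + r * f (0, 1)) := by
    have h3 : (f ((0 : X), (1 : ℝ)))⁻¹ * f ((0 : X), (1 : ℝ)) = 1 := inv_mul_cancel₀ hm.ne
    linear_combination (-r) * h3
  rw [h2]
  exact mul_nonneg_of_nonpos_of_nonpos (inv_nonpos.2 hm.le) h1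

/-- The lifted graph. -/
def liftGraph (B : Set (X × (X →L[ℝ] ℝ))) : Set (X × (X →L[ℝ] ℝ) × ℝ) :=
  {p | (p.1, p.2.1) ∈ B ∧ p.2.2 = p.2.1 p.1}

theorem hull_ineq {T : Set (X × (X →L[ℝ] ℝ) × ℝ)} (s : X) (ss : X →L[ℝ] ℝ) (k : ℝ)
    (h : ∀ x u α, (x, u, α) ∈ T → 0 ≤ α - u s - ss x + k) {x : X} {u : X →L[ℝ] ℝ} {α : ℝ}
    (hx : (x, u, α) ∈ convexHull ℝ T) : 0 ≤ α - u s - ss x + k := by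
  have hc : Convex ℝ {p : X × (X →L[ℝ] ℝ) × ℝ | 0 ≤ p.2.2 - p.2.1 s - ss p.1 + k} := by
    rintro ⟨x, u, α⟩ hx ⟨y, v, β⟩ hy a b ha hb hab
    simp only [mem_ofPred_eq, Prod.smul_mk, Prod.mk_add_mk, smul_eq_mul, add_apply,
      smul_apply, map_add, map_smul] at hx hy ⊢
    have h1 := mul_nonneg ha hx
    have h2 := mul_nonneg hb hy
    have h3 : k = a * k + b * k := by rw [← add_mul, hab, one_mul]
    rw [h3]
    nlinarith
  exact convexHull_min (fun p hp => h p.1 p.2.1 p.2.2 hp) hc hx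

theorem hull_rel {B : Set (X × (X →L[ℝ] ℝ))} (hB : IsMonotoneOp B) {s : X} {ss : X →L[ℝ] ℝ}
    (hs : (s, ss) ∈ B) {x : X} {u : X →L[ℝ] ℝ} {α : ℝ}
    (hx : (x, u, α) ∈ convexHull ℝ (liftGraph B)) : 0 ≤ α - u s - ss x + ss s := by
  refine hull_ineq s ss (ss s) ?_ hx
  rintro x u α ⟨h1, h2⟩
  have := mono_exp hB h1 hs
  simp only at h2
  linarith

theorem hull_self {B : Set (X × (X →L[ℝ] ℝ))} (hB : IsMonotoneOp B) {x : X} {u : X →L[ℝ] ℝ}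
    {α : ℝ} (hx : (x, u, α) ∈ convexHull ℝ (liftGraph B)) : u x ≤ α := by
  have := hull_ineq (T := liftGraph B) x u α (by
    rintro y v β ⟨h1, h2⟩
    have := hull_rel hB h1 hx
    simp only at h2 this
    linarith) hx
  linarith

theorem seg_dom [CompleteSpace X] {B : Set (X × (X →L[ℝ] ℝ))} (hB : IsMaxMonotoneOp B) {q c : X}
    (hq : q ∈ interior (opDom B)) (hc : c ∈ opDom B) {t : ℝ} (ht : 0 < t) (ht1 : t ≤ 1) :
    (1 - t) • c + t • q ∈ opDom B := by
  obtain ⟨δ, hδ, M, hM, hball, hbd⟩ := loc_bdd hB.1 hq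
  obtain ⟨cs, hcs⟩ := hc
  set x := (1 - t) • c + t • q with hx
  let L : (X × (X →L[ℝ] ℝ) × ℝ) → X × ℝ := fun p => (x - p.1, p.2.2 - p.2.1 x)
  have hconv : Convex ℝ (L '' convexHull ℝ (liftGraph B)) := by
    rintro _ ⟨⟨y, u, α⟩, h1, rfl⟩ _ ⟨⟨y', u', α'⟩, h2, rfl⟩ a b ha hb hab
    refine ⟨_, convex_convexHull ℝ _ h1 h2 ha hb hab, ?_⟩
    simp only [L, Prod.smul_mk, Prod.mk_add_mk, smul_eq_mul, add_apply, smul_apply]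
    refine Prod.ext ?_ ?_
    · simp only
      have : x = (a + b) • x := by rw [hab, one_smul]
      nth_rw 1 [this]
      module
    · simp only; ring
  obtain ⟨b, hb⟩ := hb_lemma (δ := t * δ)
    (R := (1 - t) * (cs c - cs x) + t * (M * (‖q - x‖ + δ))) hconv (by
      rintro r ⟨⟨y, u, α⟩, h1, h2⟩
      simp only [L, Prod.mk.injEq] at h2
      have h3 := hull_self hB.1 h1
      have h4 : x = y := sub_eq_zero.1 h2.1
      rw [← h4] at h3
      linarith [h2.2]) (by positivity) (by
      intro d hd
      have hn : ‖(q - t⁻¹ • d) - q‖ < δ := by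
        rw [sub_sub_cancel_left, norm_neg, norm_smul, norm_inv, Real.norm_of_nonneg ht.le,
          inv_mul_lt_iff₀ ht]
        exact hd
      obtain ⟨qs, hqs⟩ := interior_subset (hball (mem_ball_iff_norm.2 hn))
      have hqM := hbd _ _ hqs hn
      have h1 : (c, cs, cs c) ∈ convexHull ℝ (liftGraph B) := subset_convexHull _ _ ⟨hcs, rfl⟩
      have h2 : (q - t⁻¹ • d, qs, qs (q - t⁻¹ • d)) ∈ convexHull ℝ (liftGraph B) :=
        subset_convexHull _ _ ⟨hqs, rfl⟩
      have h3 := convex_convexHull ℝ _ h1 h2 (sub_nonneg.2 ht1) ht.le (by ring)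
      refine ⟨(1 - t) * (cs c - cs x) + t * (qs (q - t⁻¹ • d - x)), ?_, ⟨_, h3, ?_⟩⟩
      · have h5 := (abs_le.1 (apply_le_of hqM (q - t⁻¹ • d - x))).2
        have h6 : ‖q - t⁻¹ • d - x‖ ≤ ‖q - x‖ + δ := by
          have := norm_add_le (q - x) (q - t⁻¹ • d - q)
          rw [show q - x + (q - t⁻¹ • d - q) = q - t⁻¹ • d - x by abel] at this
          linarith
        have h7 : M * ‖q - t⁻¹ • d - x‖ ≤ M * (‖q - x‖ + δ) := by gcongr
        have h8 := h5.trans h7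
        gcongr
      · simp only [L, Prod.smul_mk, Prod.mk_add_mk, smul_eq_mul, add_apply, smul_apply]
        refine Prod.ext ?_ ?_
        · simp only
          rw [smul_sub, smul_inv_smul₀ ht.ne', hx]
          abel
        · simp only [map_sub]; ring)
  refine ⟨b, max_mem hB fun e es he => ?_⟩
  have := hb (x - e) (es e - es x) ⟨(e, es, es e), subset_convexHull _ _ ⟨he, rfl⟩, rfl⟩
  rw [map_sub] at this
  linarith

theorem seg_int [CompleteSpace X] {B : Set (X × (X →L[ℝ] ℝ))} (hB : IsMaxMonotoneOp B) {q c : X}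
    (hq : q ∈ interior (opDom B)) (hc : c ∈ closure (opDom B)) {t : ℝ} (ht : 0 < t) (ht1 : t ≤ 1) :
    (1 - t) • c + t • q ∈ interior (opDom B) := by
  obtain ⟨δ, hδ, hball⟩ := Metric.isOpen_iff.1 isOpen_interior q hq
  obtain ⟨c', hc', hcc⟩ := Metric.mem_closure_iff.1 hc (t * δ / 2) (by positivity)
  refine interior_maximal (s := opDom B) (t := Metric.ball ((1 - t) • c + t • q) (t * δ / 2)) ?_
    Metric.isOpen_ball (Metric.mem_ball_self (by positivity))
  intro y hy
  rw [mem_ball_iff_norm] at hy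
  rw [dist_eq_norm] at hcc
  have hq' : q + t⁻¹ • (y - ((1 - t) • c + t • q) + (1 - t) • (c - c')) ∈ Metric.ball q δ := by
    rw [mem_ball_iff_norm, add_sub_cancel_left, norm_smul, norm_inv, Real.norm_of_nonneg ht.le,
      inv_mul_lt_iff₀ ht]
    have h1 := norm_add_le (y - ((1 - t) • c + t • q)) ((1 - t) • (c - c'))
    rw [norm_smul, Real.norm_of_nonneg (sub_nonneg.2 ht1)] at h1
    nlinarith [norm_nonneg (c - c')]
  have := seg_dom hB (hball hq') hc' ht ht1
  convert this using 1
  rw [smul_add, smul_inv_smul₀ ht.ne']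
  module

theorem conv_int [CompleteSpace X] {B : Set (X × (X →L[ℝ] ℝ))} (hB : IsMaxMonotoneOp B) :
    Convex ℝ (interior (opDom B)) := by
  intro x hx y hy a b ha hb hab
  rcases hb.eq_or_lt with rfl | hb
  · have : a = 1 := by linarith
    simpa [this] using hx
  · have := seg_int hB hy (subset_closure (interior_subset hx)) hb (by linarith)
    rwa [show 1 - b = a by linarith] at this

/-- Bounded nets: the graph is sequentially closed in norm times bounded weak-star. -/
theorem dom_of_bdd {B : Set (X × (X →L[ℝ] ℝ))} (hB : IsMaxMonotoneOp B) {p : X} {R : ℝ}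
    (h : ∀ r > 0, ∃ a b, (a, b) ∈ B ∧ ‖a - p‖ < r ∧ ‖b‖ ≤ R) : p ∈ opDom B := by
  choose a b hab har hbR using fun n : ℕ => h (1 / ((n : ℝ) + 1)) (by positivity)
  have ha : Tendsto (fun n => ‖a n - p‖) atTop (𝓝 0) :=
    squeeze_zero (fun _ => norm_nonneg _) (fun n => (har n).le)
      tendsto_one_div_add_atTop_nhds_zero_nat
  have hK := WeakDual.isCompact_closedBall (𝕜 := ℝ) (E := X) 0 R
  let 𝒰 : Ultrafilter ℕ := Ultrafilter.of atTop
  have hU : (𝒰 : Filter ℕ) ≤ atTop := Ultrafilter.of_le _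
  obtain ⟨β, hβ, hlim⟩ := hK.ultrafilter_le_nhds (𝒰.map fun n => StrongDual.toWeakDual (b n)) (by
    rw [le_principal_iff, Ultrafilter.coe_map, Filter.mem_map]
    refine Filter.univ_mem' fun n => ?_
    show (b n) ∈ Metric.closedBall (0 : X →L[ℝ] ℝ) R
    simpa using hbR n)
  have hev : ∀ x : X, Tendsto (fun n => b n x) 𝒰 (𝓝 (β x)) := fun x =>
    ((WeakDual.eval_continuous x).tendsto β).comp hlim
  refine ⟨WeakDual.toStrongDual β, max_mem hB fun c cs hc => ?_⟩
  have h1 : Tendsto (fun n => b n p - b n c - cs p + cs c + (R + ‖cs‖) * ‖a n - p‖) 𝒰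
      (𝓝 (β p - β c - cs p + cs c + (R + ‖cs‖) * 0)) :=
    ((((hev p).sub (hev c)).sub_const _).add_const _).add ((ha.mono_left hU).const_mul _)
  have h2 : 0 ≤ β p - β c - cs p + cs c + (R + ‖cs‖) * 0 := by
    refine ge_of_tendsto h1 (Filter.Eventually.of_forall fun n => ?_)
    have h3 := mono_exp hB.1 (hab n) hc
    have h4 := (abs_le.1 (apply_le_of (hbR n) (a n - p))).2
    have h5 := (abs_le.1 (apply_le_of (le_refl ‖cs‖) (a n - p))).1
    rw [map_sub] at h4 h5
    linarith
  simpa using h2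

theorem fpv_approx {A : Set (X × (X →L[ℝ] ℝ))} (hA : IsFPV A) {W : Set X} (hW : IsOpen W)
    (hWc : Convex ℝ W) (hne : (W ∩ opDom A).Nonempty) {v : X} (hv : v ∈ W) (vs : X →L[ℝ] ℝ)
    {η : ℝ} (hη : 0 < η) :
    ∃ a as, (a, as) ∈ A ∧ a ∈ W ∧ vs v - vs a - as v + as a < η := by
  by_contra hcon
  push Not at hcon
  have h1 : (v, vs) ∈ A := by
    refine hA.2 W hW hWc hne v vs hv ?_
    rintro ⟨a, as⟩ ⟨h1, h2⟩
    have := hcon a as h1 h2.1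
    simp only [sub_apply, map_sub]
    linarith
  have := hcon v vs h1 hv
  linarith

theorem two_pt (x1 x3 a : X) (f1 f3 g : X →L[ℝ] ℝ) {α γ : ℝ} (h : α + γ = 1) :
    α * (f1 x1 - f1 a - g x1 + g a) + γ * (f3 x3 - f3 a - g x3 + g a) =
    ((α • f1 + γ • f3) (α • x1 + γ • x3) - (α • f1 + γ • f3) a
      - g (α • x1 + γ • x3) + g a) + α * γ * (f1 x1 - f1 x3 - f3 x1 + f3 x3) := by
  obtain rfl : α = 1 - γ := by linarith
  simp only [add_apply, smul_apply, map_add, map_smul, smul_eq_mul]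
  ring

theorem three_pt (x1 x2 x3 a : X) (f1 f2 f3 g : X →L[ℝ] ℝ) {α β γ : ℝ} (h : α + β + γ = 1) :
    α * (f1 x1 - f1 a - g x1 + g a) + β * (f2 x2 - f2 a - g x2 + g a)
      + γ * (f3 x3 - f3 a - g x3 + g a) =
    ((α • f1 + β • f2 + γ • f3) (α • x1 + β • x2 + γ • x3) - (α • f1 + β • f2 + γ • f3) a
      - g (α • x1 + β • x2 + γ • x3) + g a) + α * β * (f1 x1 - f1 x2 - f2 x1 + f2 x2)
      + α * γ * (f1 x1 - f1 x3 - f3 x1 + f3 x3) + β * γ * (f2 x2 - f2 x3 - f3 x2 + f3 x3) := by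
  obtain rfl : β = 1 - α - γ := by linarith
  simp only [add_apply, smul_apply, map_add, map_smul, smul_eq_mul]
  ring

/-- A boundary point of `dom B` in `dom A` lying strictly between `int dom B` and `z` cannot be
in `dom B`. -/
theorem normal_case [CompleteSpace X] {A B : Set (X × (X →L[ℝ] ℝ))}
    (hB : IsMaxMonotoneOp B) {U : Set X} {z : X} {zs : X →L[ℝ] ℝ}
    (H : ∀ a as bs, (a, as) ∈ A → (a, bs) ∈ B → a ∈ U →
      0 ≤ zs z - zs a - as z + as a - bs z + bs a)
    {q p : X} (hq : q ∈ interior (opDom B)) {s : ℝ} (hs : 0 < s) (hs1 : s < 1)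
    (hp : p = (1 - s) • q + s • z) (hpU : p ∈ U) (hpA : p ∈ opDom A)
    (hpi : p ∉ interior (opDom B)) : p ∉ opDom B := by
  rintro ⟨bs, hbs⟩
  obtain ⟨as, has⟩ := hpA
  obtain ⟨n, hn⟩ := geometric_hahn_banach_open_point (conv_int hB) isOpen_interior hpi
  have hnq := hn q hq
  have hnc : ∀ c ∈ opDom B, n c ≤ n p := by
    intro c hc
    by_contra hcon
    push Not at hcon
    have hD : 0 < n c - n p := by linarith
    have hE : 0 < n p - n q := by linarith
    set D := n c - n p with hDd
    set E := n p - n q with hEd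
    have ht0 : 0 < D / (D + E) / 2 := by positivity
    have ht1 : D / (D + E) / 2 ≤ 1 := by
      rw [div_div, div_le_one (by positivity)]; linarith
    have h1 := hn _ (seg_int hB hq (subset_closure hc) ht0 ht1)
    simp only [map_add, map_smul, smul_eq_mul] at h1
    have h2 : D / (D + E) / 2 * (D + E) = D / 2 := by field_simp
    set t := D / (D + E) / 2
    have h3 : n c = n p + D := by linarith
    have h4 : n q = n p - E := by linarith
    rw [h3, h4] at h1
    nlinarith
  have hg : 0 < n z - n p := by
    have h1 : n p = (1 - s) * n q + s * n z := by
      conv_lhs => rw [hp]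
      simp
    have h2 : s * (n z - n p) = (1 - s) * (n p - n q) := by linarith
    have h3 : 0 < (1 - s) * (n p - n q) := mul_pos (by linarith) (by linarith)
    rw [← h2] at h3
    exact (mul_pos_iff_of_pos_left hs).1 h3
  set K := zs z - zs p - as z + as p - bs z + bs p with hK
  have hlam : 0 ≤ (|K| + 1) / (n z - n p) := by positivity
  have hmem : (p, bs + ((|K| + 1) / (n z - n p)) • n) ∈ B := by
    refine max_mem hB fun c cs hc => ?_
    have h1 := mono_exp hB.1 hbs hc
    have h2 := hnc c ⟨cs, hc⟩
    have h3 := mul_nonneg hlam (sub_nonneg.2 h2)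
    simp only [add_apply, smul_apply, smul_eq_mul]
    linarith
  have h1 := H p as _ has hmem hpU
  simp only [add_apply, smul_apply, smul_eq_mul] at h1
  have h2 : (|K| + 1) / (n z - n p) * (n z - n p) = |K| + 1 := by field_simp
  have h3 := le_abs_self K
  linarith

set_option maxHeartbeats 1600000 in
theorem blowup_case [CompleteSpace X] {A B : Set (X × (X →L[ℝ] ℝ))}
    (hA : IsFPV A) (hconv : Convex ℝ (opDom A))
    (hB : IsMaxMonotoneOp B) {U : Set X} (hU : IsOpen U) (hUc : Convex ℝ U) {z : X}
    {zs : X →L[ℝ] ℝ}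
    (H : ∀ a as bs, (a, as) ∈ A → (a, bs) ∈ B → a ∈ U →
      0 ≤ zs z - zs a - as z + as a - bs z + bs a)
    {a0 : X} (ha0 : a0 ∈ opDom A) (ha0B : a0 ∈ interior (opDom B))
    {q p : X} (hq : q ∈ interior (opDom B)) {s : ℝ} (hs : 0 < s) (hs1 : s < 1)
    (hp : p = (1 - s) • q + s • z) (hpU : p ∈ U) (hpA : p ∈ opDom A)
    (hpc : p ∈ closure (opDom B)) : p ∈ opDom B := by
  have ha0' := ha0
  have hpA' := hpA
  obtain ⟨a0s, ha0s⟩ := ha0'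
  obtain ⟨cs, hcs⟩ := hpA'
  obtain ⟨δ, hδ, M, hM, hball, hbd⟩ := loc_bdd hB.1 hq
  obtain ⟨r0, hr0, hr0B⟩ := Metric.isOpen_iff.1 isOpen_interior a0 ha0B
  obtain ⟨rU, hrU, hrUU⟩ := Metric.isOpen_iff.1 hU p hpU
  obtain ⟨κ, hκ⟩ : ∃ κ, κ = (1 - s) / s := ⟨_, rfl⟩
  have hκ0 : 0 < κ := by rw [hκ]; exact div_pos (by linarith) hs
  have hzp : z - p = κ • (p - q) := by
    have h1 : s • (z - p) = s • (κ • (p - q)) := by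
      rw [smul_smul, hκ, mul_div_cancel₀ _ hs.ne', hp]
      module
    exact smul_right_injective X hs.ne' h1
  set L' := κ * ‖a0 - q‖ / r0 + 1 with hL'
  have hL'0 : 0 < L' := by positivity
  have hm : a0 + (κ / L') • (a0 - q) ∈ interior (opDom B) := by
    refine hr0B ?_
    rw [mem_ball_iff_norm, add_sub_cancel_left, norm_smul, Real.norm_of_nonneg (by positivity),
      div_mul_eq_mul_div, div_lt_iff₀ hL'0, hL', mul_add, mul_div_cancel₀ _ hr0.ne']
    linarith
  set L := κ + L' with hL
  have hL0 : 0 < L := by positivity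
  set X1 := a0s a0 - a0s p - cs a0 + cs p with hX1
  set X2 := a0s a0 - a0s z - zs a0 + zs z with hX2
  set X3 := cs p - cs z - zs p + zs z with hX3
  set K0 := L * |X1| + L * |X2| + |X3| with hK0
  have hK00 : 0 ≤ K0 := by positivity
  refine dom_of_bdd hB (R := ((1 + K0) / κ + M * (‖p - q‖ + 1 + δ)) / (δ / 4)) ?_
  intro r hr
  obtain ⟨r', hr'⟩ : ∃ r', r' = min (min r 1) (min rU (δ / 2 / (1 + 1 / κ))) := ⟨_, rfl⟩
  have hr'0 : 0 < r' := by rw [hr']; positivity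
  have hr'1 : r' ≤ r := by rw [hr']; exact (min_le_left _ _).trans (min_le_left _ _)
  have hr'2 : r' ≤ 1 := by rw [hr']; exact (min_le_left _ _).trans (min_le_right _ _)
  have hr'3 : r' ≤ rU := by rw [hr']; exact (min_le_right _ _).trans (min_le_left _ _)
  have hr'4 : (1 + 1 / κ) * r' ≤ δ / 2 := by
    have : r' ≤ δ / 2 / (1 + 1 / κ) := by
      rw [hr']; exact (min_le_right _ _).trans (min_le_right _ _)
    rwa [le_div_iff₀ (by positivity), mul_comm] at this
  -- the open convex set
  have hWo : IsOpen (Metric.ball p r' ∩ interior (opDom B)) :=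
    Metric.isOpen_ball.inter isOpen_interior
  have hWc : Convex ℝ (Metric.ball p r' ∩ interior (opDom B)) :=
    (convex_ball _ _).inter (conv_int hB)
  have hWne : ((Metric.ball p r' ∩ interior (opDom B)) ∩ opDom A).Nonempty := by
    obtain ⟨τ, hτ⟩ : ∃ τ, τ = min 1 (r' / (2 * (‖a0 - p‖ + 1))) := ⟨_, rfl⟩
    have hτ0 : 0 < τ := by rw [hτ]; positivity
    have hτ1 : τ ≤ 1 := by rw [hτ]; exact min_le_left _ _
    have hτ2 : τ * (2 * (‖a0 - p‖ + 1)) ≤ r' := by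
      have : τ ≤ r' / (2 * (‖a0 - p‖ + 1)) := by rw [hτ]; exact min_le_right _ _
      rwa [le_div_iff₀ (by positivity)] at this
    refine ⟨(1 - τ) • p + τ • a0, ⟨?_, seg_int hB ha0B hpc hτ0 hτ1⟩,
      hconv hpA ha0 (by linarith) hτ0.le (by ring)⟩
    rw [mem_ball_iff_norm, show (1 - τ) • p + τ • a0 - p = τ • (a0 - p) by module, norm_smul,
      Real.norm_of_nonneg hτ0.le]
    nlinarith [norm_nonneg (a0 - p)]
  obtain ⟨γ, hγ⟩ : ∃ γ, γ = min (1 / (1 + L)) (r' / (2 * (‖z - p + L • (a0 - p)‖ + 1))) := ⟨_, rfl⟩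
  have hγ0 : 0 < γ := by rw [hγ]; positivity
  have hγ1 : γ * (1 + L) ≤ 1 := by
    have : γ ≤ 1 / (1 + L) := by rw [hγ]; exact min_le_left _ _
    rwa [le_div_iff₀ (by positivity)] at this
  have hγ2 : γ * (2 * (‖z - p + L • (a0 - p)‖ + 1)) ≤ r' := by
    have : γ ≤ r' / (2 * (‖z - p + L • (a0 - p)‖ + 1)) := by rw [hγ]; exact min_le_right _ _
    rwa [le_div_iff₀ (by positivity)] at this
  have hsum : γ * L + (1 - γ - γ * L) + γ = 1 := by ring
  have hv : (γ * L) • a0 + (1 - γ - γ * L) • p + γ • z ∈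
      Metric.ball p r' ∩ interior (opDom B) := by
    constructor
    · rw [mem_ball_iff_norm, show (γ * L) • a0 + (1 - γ - γ * L) • p + γ • z - p =
        γ • (z - p + L • (a0 - p)) by module, norm_smul, Real.norm_of_nonneg hγ0.le]
      nlinarith [norm_nonneg (z - p + L • (a0 - p))]
    · have h1 := seg_int hB hm hpc (t := γ * L') (by positivity) (by nlinarith)
      convert h1 using 1
      have h2 : (γ * L) • a0 + (1 - γ - γ * L) • p + γ • z =
          γ • (z - p) + (γ * L) • (a0 - p) + p := by module
      have h3 : (γ * L') • (a0 + (κ / L') • (a0 - q)) = (γ * L') • a0 + (γ * κ) • (a0 - q) := by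
        rw [smul_add, smul_smul]
        congr 2
        field_simp
      rw [h2, hzp, h3, hL]
      module
  obtain ⟨a, as, haA, ⟨haW, haB⟩, hlt⟩ := fpv_approx hA hWo hWc hWne hv
    ((γ * L) • a0s + (1 - γ - γ * L) • cs + γ • zs) hγ0
  have h3 := three_pt a0 p z a a0s cs zs as hsum
  have hqa0 := mono_exp hA.1.1 ha0s haA
  have hqp := mono_exp hA.1.1 hcs haA
  rw [← hX1, ← hX2, ← hX3] at h3
  have hα0 : 0 ≤ γ * L := by positivity
  have hβ0 : 0 ≤ 1 - γ - γ * L := by linarith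
  have hβ1 : 1 - γ - γ * L ≤ 1 := by linarith
  have hα1 : γ * L ≤ 1 := by linarith
  have hγ11 : γ ≤ 1 := by linarith
  have e1 : γ * L * (1 - γ - γ * L) * X1 ≤ γ * L * |X1| := by
    have := le_abs_self X1
    calc γ * L * (1 - γ - γ * L) * X1 ≤ γ * L * (1 - γ - γ * L) * |X1| := by gcongr
      _ ≤ γ * L * 1 * |X1| := by gcongr
      _ = _ := by ring
  have e2 : γ * L * γ * X2 ≤ γ * L * |X2| := by
    have := le_abs_self X2
    calc γ * L * γ * X2 ≤ γ * L * γ * |X2| := by gcongr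
      _ ≤ γ * L * 1 * |X2| := by gcongr
      _ = _ := by ring
  have e3 : (1 - γ - γ * L) * γ * X3 ≤ γ * |X3| := by
    have := le_abs_self X3
    calc (1 - γ - γ * L) * γ * X3 ≤ (1 - γ - γ * L) * γ * |X3| := by gcongr
      _ ≤ 1 * γ * |X3| := by gcongr
      _ = _ := by ring
  have hqz : zs z - zs a - as z + as a < 1 + K0 := by
    have h4 := mul_nonneg hα0 hqa0
    have h5 := mul_nonneg hβ0 hqp
    have h6 : γ * (zs z - zs a - as z + as a) < γ * (1 + K0) := by
      rw [hK0]
      linarith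
    exact lt_of_mul_lt_mul_left h6 hγ0.le
  obtain ⟨bs, hbs⟩ := interior_subset haB
  rw [mem_ball_iff_norm] at haW
  have haU : a ∈ U := hrUU (by rw [mem_ball_iff_norm]; linarith)
  have hH := H a as bs haA hbs haU
  refine ⟨a, bs, hbs, by linarith, norm_le_of_unit (by positivity) fun u hu => ?_⟩
  -- test point near q
  have hqu : ‖(a - κ⁻¹ • (z - a) + (δ / 4) • u) - q‖ < δ := by
    have h7 : (a - κ⁻¹ • (z - a) + (δ / 4) • u) - q = (1 + 1 / κ) • (a - p) + (δ / 4) • u := by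
      have h8 : κ⁻¹ • (z - a) = (p - q) - κ⁻¹ • (a - p) := by
        rw [show z - a = (z - p) - (a - p) by abel, smul_sub, hzp, inv_smul_smul₀ hκ0.ne']
      rw [h8, one_div]
      module
    rw [h7]
    have h9 := norm_add_le ((1 + 1 / κ) • (a - p)) ((δ / 4) • u)
    rw [norm_smul, norm_smul, Real.norm_of_nonneg (by positivity : 0 ≤ 1 + 1 / κ),
      Real.norm_of_nonneg (by positivity : 0 ≤ δ / 4)] at h9
    have h10 : (1 + 1 / κ) * ‖a - p‖ ≤ (1 + 1 / κ) * r' := by gcongr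
    have h11 : δ / 4 * ‖u‖ ≤ δ / 4 := by nlinarith
    linarith
  obtain ⟨qs, hqs⟩ := interior_subset (hball (mem_ball_iff_norm.2 hqu))
  have hqM := hbd _ _ hqs hqu
  have hmon := mono_exp hB.1 hbs hqs
  set qu := a - κ⁻¹ • (z - a) + (δ / 4) • u with hqud
  have h12 := (abs_le.1 (apply_le_of hqM (a - qu))).1
  have h13 : ‖a - qu‖ ≤ ‖p - q‖ + 1 + δ := by
    have h14 := norm_add₃_le (a := a - p) (b := p - q) (c := q - qu)
    rw [show a - p + (p - q) + (q - qu) = a - qu by abel, norm_sub_rev q qu] at h14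
    linarith
  have h15 : M * ‖a - qu‖ ≤ M * (‖p - q‖ + 1 + δ) := by gcongr
  have h16 : bs qu = bs a - κ⁻¹ * (bs z - bs a) + δ / 4 * bs u := by
    rw [hqud]; simp
  have h17 : κ⁻¹ * (bs z - bs a) ≤ (1 + K0) / κ := by
    rw [div_eq_inv_mul]
    have : bs z - bs a ≤ 1 + K0 := by linarith
    gcongr
  rw [map_sub] at h12
  rw [le_div_iff₀ (by positivity)]
  linarith

/-- The open cone-like convex set with apex `z` over the ball of radius `δ` around `a0`. -/
def coneSet (a0 z : X) (δ : ℝ) : Set X :=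
  {x | ∃ s : ℝ, 0 ≤ s ∧ s < 1 ∧ ‖x - ((1 - s) • a0 + s • z)‖ < (1 - s) * δ}

theorem coneSet_open (a0 z : X) (δ : ℝ) : IsOpen (coneSet a0 z δ) := by
  have : coneSet a0 z δ =
      ⋃ s ∈ Ico (0 : ℝ) 1, Metric.ball ((1 - s) • a0 + s • z) ((1 - s) * δ) := by
    ext x
    simp [coneSet, dist_eq_norm, and_assoc]
  rw [this]
  exact isOpen_biUnion fun s _ => Metric.isOpen_ball

theorem coneSet_convex (a0 z : X) (δ : ℝ) : Convex ℝ (coneSet a0 z δ) := by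
  rintro x ⟨s, hs0, hs1, hs⟩ y ⟨t, ht0, ht1, ht⟩ a b ha hb hab
  have hb' : b = 1 - a := by linarith
  have hlt : a * s + b * t < 1 := by
    rcases ha.eq_or_lt with rfl | ha
    · have : b = 1 := by linarith
      rw [this]; linarith
    · have h1 : a * s < a * 1 := by gcongr
      have h2 : b * t ≤ b * 1 := by gcongr
      linarith
  refine ⟨a * s + b * t, by positivity, hlt, ?_⟩
  have h1 : a • x + b • y - ((1 - (a * s + b * t)) • a0 + (a * s + b * t) • z) =
      a • (x - ((1 - s) • a0 + s • z)) + b • (y - ((1 - t) • a0 + t • z)) := by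
    rw [hb']; module
  rw [h1]
  have h2 := norm_add_le (a • (x - ((1 - s) • a0 + s • z))) (b • (y - ((1 - t) • a0 + t • z)))
  rw [norm_smul, norm_smul, Real.norm_of_nonneg ha, Real.norm_of_nonneg hb] at h2
  have h3 : a * ‖x - ((1 - s) • a0 + s • z)‖ + b * ‖y - ((1 - t) • a0 + t • z)‖ <
      a * ((1 - s) * δ) + b * ((1 - t) * δ) := by
    rcases ha.eq_or_lt with rfl | ha
    · have : b = 1 := by linarith
      rw [this]; linarith
    · have h4 : a * ‖x - ((1 - s) • a0 + s • z)‖ < a * ((1 - s) * δ) := by gcongr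
      have h5 : b * ‖y - ((1 - t) • a0 + t • z)‖ ≤ b * ((1 - t) * δ) := by gcongr
      linarith
  have h6 : a * ((1 - s) * δ) + b * ((1 - t) * δ) = (1 - (a * s + b * t)) * δ := by
    rw [hb']; ring
  linarith

theorem coneSet_rep {a0 z : X} {δ : ℝ} {x : X} (hx : x ∈ coneSet a0 z δ) :
    ∃ (s : ℝ) (c : X), 0 ≤ s ∧ s < 1 ∧ ‖c - a0‖ < δ ∧ x = (1 - s) • c + s • z := by
  obtain ⟨s, hs0, hs1, hs⟩ := hx
  have h1 : 0 < 1 - s := by linarith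
  refine ⟨s, (1 - s)⁻¹ • (x - s • z), hs0, hs1, ?_, ?_⟩
  · have h2 : (1 - s)⁻¹ • (x - s • z) - a0 = (1 - s)⁻¹ • (x - ((1 - s) • a0 + s • z)) := by
      rw [← sub_sub, sub_right_comm, smul_sub _ _ ((1 - s) • a0), inv_smul_smul₀ h1.ne']
    rw [h2, norm_smul, norm_inv, Real.norm_of_nonneg h1.le, inv_mul_lt_iff₀ h1]
    exact hs
  · rw [smul_inv_smul₀ h1.ne']; abel

/-- The Fitzpatrick inequality for the (localised) sum. -/
theorem star_ineq [CompleteSpace X] {A B : Set (X × (X →L[ℝ] ℝ))}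
    (hA : IsFPV A) (hconv : Convex ℝ (opDom A))
    (hB : IsMaxMonotoneOp B) {U : Set X} (hU : IsOpen U) (hUc : Convex ℝ U)
    {a0 : X} (ha0 : a0 ∈ opDom A) (ha0B : a0 ∈ interior (opDom B)) (ha0U : a0 ∈ U)
    {z : X} (hz : z ∈ U) (zs : X →L[ℝ] ℝ) {ε : ℝ} (hε : 0 < ε) :
    ∃ a as bs, (a, as) ∈ A ∧ (a, bs) ∈ B ∧ a ∈ U ∧
      zs z - zs a - as z + as a - bs z + bs a < ε := by
  by_contra hcon
  push Not at hcon
  have H : ∀ a as bs, (a, as) ∈ A → (a, bs) ∈ B → a ∈ U →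
      0 ≤ zs z - zs a - as z + as a - bs z + bs a :=
    fun a as bs h1 h2 h3 => hε.le.trans (hcon a as bs h1 h2 h3)
  have ha0' := ha0
  obtain ⟨a0s, ha0s⟩ := ha0'
  have hne : z ≠ a0 := by
    rintro rfl
    obtain ⟨bs, hbs⟩ := interior_subset ha0B
    have := hcon _ _ _ ha0s hbs ha0U
    linarith
  have hn : 0 < ‖z - a0‖ := norm_pos_iff.2 (sub_ne_zero.2 hne)
  obtain ⟨δ0, hδ0, M, hM, hball, hbd⟩ := loc_bdd hB.1 ha0B
  obtain ⟨δ, hδd⟩ : ∃ δ, δ = min δ0 (‖z - a0‖ / 2) := ⟨_, rfl⟩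
  have hδ : 0 < δ := by rw [hδd]; positivity
  have hδ1 : δ ≤ δ0 := by rw [hδd]; exact min_le_left _ _
  have hδ2 : δ ≤ ‖z - a0‖ / 2 := by rw [hδd]; exact min_le_right _ _
  obtain ⟨f, hf1, hf2⟩ := exists_dual_vector ℝ (z - a0) hn.ne'
  have hf2 : f (z - a0) = ‖z - a0‖ := hf2
  have hfc : ∀ c, ‖c - a0‖ < δ → ‖z - c‖ ≤ 3 * f (z - c) := by
    intro c hc
    have h1 := (abs_le.1 (apply_le_of hf1.le (c - a0))).2
    have h2 : f (z - c) = f (z - a0) - f (c - a0) := by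
      rw [← map_sub, sub_sub_sub_cancel_right]
    have h3 := norm_sub_le (z - a0) (c - a0)
    rw [sub_sub_sub_cancel_right] at h3
    linarith
  set ws := zs + (3 * M) • f with hws
  set Y := a0s a0 - a0s z - ws a0 + ws z with hY
  obtain ⟨τ, hτ⟩ : ∃ τ, τ = min (1 / 2) (ε / (2 * (|Y| + 1))) := ⟨_, rfl⟩
  have hτ0 : 0 < τ := by rw [hτ]; positivity
  have hτ1 : τ ≤ 1 / 2 := by rw [hτ]; exact min_le_left _ _
  have hτ2 : τ * (2 * (|Y| + 1)) ≤ ε := by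
    have : τ ≤ ε / (2 * (|Y| + 1)) := by rw [hτ]; exact min_le_right _ _
    rwa [le_div_iff₀ (by positivity)] at this
  have hWo : IsOpen (coneSet a0 z δ ∩ U) := (coneSet_open _ _ _).inter hU
  have hWc : Convex ℝ (coneSet a0 z δ ∩ U) := (coneSet_convex _ _ _).inter hUc
  have ha0W : a0 ∈ coneSet a0 z δ ∩ U := ⟨⟨0, le_refl _, one_pos, by simpa using hδ⟩, ha0U⟩
  have hv : τ • a0 + (1 - τ) • z ∈ coneSet a0 z δ ∩ U := by
    refine ⟨⟨1 - τ, by linarith, by linarith, ?_⟩,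
      hUc ha0U hz hτ0.le (by linarith) (by ring)⟩
    rw [sub_sub_cancel, sub_self, norm_zero]; positivity
  obtain ⟨a, as, haA, haW, hlt⟩ := fpv_approx hA hWo hWc ⟨a0, ha0W, ha0⟩ hv
    (τ • a0s + (1 - τ) • ws) (η := (1 - τ) * (ε / 2)) (mul_pos (by linarith) (by positivity))
  have h2 := two_pt a0 z a a0s ws as (α := τ) (γ := 1 - τ) (by ring)
  have hqa0 := mono_exp hA.1.1 ha0s haA
  have hqz : ws z - ws a - as z + as a < ε := by
    have h3 : τ * Y ≤ ε / 2 := by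
      have : τ * Y ≤ τ * |Y| := by gcongr; exact le_abs_self _
      linarith
    have h4 := mul_nonneg hτ0.le hqa0
    have h5 : (1 - τ) * (ws z - ws a - as z + as a) < (1 - τ) * ε := by
      rw [← hY] at h2
      have h6 : (1 - τ) * (τ * Y) ≤ (1 - τ) * (ε / 2) :=
        mul_le_mul_of_nonneg_left h3 (by linarith)
      linarith
    exact lt_of_mul_lt_mul_left h5 (by linarith)
  by_cases haB : a ∈ opDom B
  · obtain ⟨bs, hbs⟩ := haB
    have h1 := hcon a as bs haA hbs haW.2
    obtain ⟨s, c, hs0, hs1, hc, hac⟩ := coneSet_rep haW.1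
    have hza : z - a = (1 - s) • (z - c) := by rw [hac]; module
    have h3 : -(M * ‖z - c‖) ≤ bs (z - c) := by
      rcases hs0.eq_or_lt with rfl | hs0
      · have hac' : a = c := by rw [hac]; simp
        have := hbd a bs hbs (by rw [hac']; linarith)
        exact (abs_le.1 (apply_le_of this (z - c))).1
      · obtain ⟨cs, hcs⟩ := interior_subset (hball (mem_ball_iff_norm.2 (by linarith : ‖c - a0‖ < δ0)))
        have hcM := hbd c cs hcs (by linarith)
        have h4 := (abs_le.1 (apply_le_of hcM (z - c))).1
        have h5 := mono_exp hB.1 hbs hcs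
        have h6 : a = c + s • (z - c) := by rw [hac]; module
        have h7 : s * (bs (z - c) - cs (z - c)) = bs a - bs c - cs a + cs c := by
          rw [h6]; simp only [map_add, map_smul, smul_eq_mul]; ring
        rw [← h7] at h5
        have h8 : 0 ≤ bs (z - c) - cs (z - c) := nonneg_of_mul_nonneg_right h5 hs0
        linarith
    have h9 := mul_le_mul_of_nonneg_left (hfc c hc) hM
    have h10 : 0 ≤ (1 - s) * (3 * M * f (z - c) + bs (z - c)) :=
      mul_nonneg (by linarith) (by linarith)
    have h11 : (1 - s) * (3 * M * f (z - c) + bs (z - c)) =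
        3 * M * (f z - f a) + (bs z - bs a) := by
      rw [← map_sub, ← map_sub, hza]
      simp only [map_smul, smul_eq_mul]
      ring
    rw [h11] at h10
    simp only [hws, add_apply, smul_apply, smul_eq_mul] at hqz
    linarith
  · -- find the exit point of the segment from `a0` to `a`
    let g : ℝ → X := fun t => (1 - t) • a0 + t • a
    have hg : Continuous g := by fun_prop
    have hcomp : IsCompact (Icc (0 : ℝ) 1 ∩ g ⁻¹' closure (opDom B)) :=
      isCompact_Icc.inter_right (isClosed_closure.preimage hg)
    obtain ⟨t, ⟨⟨ht0, ht1⟩, htc⟩, htmax⟩ := hcomp.exists_isGreatest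
      ⟨0, ⟨le_refl _, zero_le_one⟩, by
        simp only [g, mem_preimage, sub_zero, one_smul, zero_smul, add_zero]
        exact subset_closure (interior_subset ha0B)⟩
    have hgi : g t ∉ interior (opDom B) := by
      intro hi
      rcases ht1.eq_or_lt with rfl | ht1
      · apply haB
        have := interior_subset hi
        simpa [g] using this
      · obtain ⟨e, he, hee⟩ := Metric.isOpen_iff.1 (isOpen_interior.preimage hg) t hi
        have h3 : t + min (e / 2) (1 - t) ≤ t := by
          refine htmax ⟨⟨by positivity, ?_⟩, ?_⟩
          · have := min_le_right (e / 2) (1 - t); linarith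
          · refine subset_closure (interior_subset (hee ?_))
            have hp : 0 < min (e / 2) (1 - t) := lt_min (by linarith) (by linarith)
            rw [mem_ball_iff_norm, add_sub_cancel_left, Real.norm_of_nonneg hp.le]
            have := min_le_left (e / 2) (1 - t); linarith
        have hp : 0 < min (e / 2) (1 - t) := lt_min (by linarith) (by linarith)
        linarith
    have hgA : g t ∈ opDom A := hconv ha0 ⟨as, haA⟩ (by linarith) ht0 (by ring)
    have hgW : g t ∈ coneSet a0 z δ ∩ U := hWc ha0W haW (by linarith) ht0 (by ring)
    obtain ⟨s, c, hs0, hs1, hc, hgc⟩ := coneSet_rep hgW.1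
    have hci : c ∈ interior (opDom B) := hball (mem_ball_iff_norm.2 (by linarith))
    have hs : 0 < s := by
      rcases hs0.eq_or_lt with rfl | hs0
      · exact absurd (by rw [hgc]; simpa using hci) hgi
      · exact hs0
    exact normal_case hB H hci hs hs1 hgc hgW.2 hgA hgi
      (blowup_case hA hconv hB hU hUc H ha0 ha0B hci hs hs1 hgc hgW.2 hgA htc)

theorem fpv_sum_mem [CompleteSpace X] {A B : Set (X × (X →L[ℝ] ℝ))}
    (hA : IsFPV A) (hconv : Convex ℝ (opDom A))
    (hB : IsMaxMonotoneOp B) {U : Set X} (hU : IsOpen U) (hUc : Convex ℝ U)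
    {a0 : X} (ha0 : a0 ∈ opDom A) (ha0B : a0 ∈ interior (opDom B)) (ha0U : a0 ∈ U)
    {z : X} (hz : z ∈ U) (zs : X →L[ℝ] ℝ)
    (H : ∀ a as bs, (a, as) ∈ A → (a, bs) ∈ B → a ∈ U →
      0 ≤ zs z - zs a - as z + as a - bs z + bs a) :
    ∃ b, (z, zs - b) ∈ A ∧ (z, b) ∈ B := by
  have ha0' := ha0
  obtain ⟨a0s, ha0s⟩ := ha0'
  set AU := A ∩ (U ×ˢ (univ : Set (X →L[ℝ] ℝ))) with hAU
  let L : (X × (X →L[ℝ] ℝ) × ℝ) × (X × (X →L[ℝ] ℝ) × ℝ) → X × ℝ := fun p =>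
    (p.1.1 - p.2.1, zs z - zs p.1.1 - p.1.2.1 z + p.1.2.2 - p.2.2.1 z + p.2.2.2)
  have hSc : Convex ℝ (L '' (convexHull ℝ (liftGraph AU) ×ˢ convexHull ℝ (liftGraph B))) := by
    rintro _ ⟨⟨⟨y, u, α⟩, ⟨y', u', α'⟩⟩, h1, rfl⟩ _ ⟨⟨⟨x, v, β⟩, ⟨x', v', β'⟩⟩, h2, rfl⟩ a b ha hb hab
    refine ⟨_, ((convex_convexHull ℝ (liftGraph AU)).prod (convex_convexHull ℝ (liftGraph B)))
      h1 h2 ha hb hab, ?_⟩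
    obtain rfl : a = 1 - b := by linarith
    simp only [L, Prod.smul_mk, Prod.mk_add_mk, smul_eq_mul, add_apply, smul_apply, map_add,
      map_smul]
    refine Prod.ext ?_ ?_
    · simp only
      module
    · simp only; ring
  have hmA : ∀ {x : X} {u : X →L[ℝ] ℝ} {α : ℝ}, (x, u, α) ∈ convexHull ℝ (liftGraph AU) →
      (x, u, α) ∈ convexHull ℝ (liftGraph A) := fun h =>
    convexHull_mono (s := liftGraph AU) (t := liftGraph A)
      (fun p hp => And.intro hp.1.1 hp.2) h
  have hmU : ∀ {x : X} {u : X →L[ℝ] ℝ} {α : ℝ}, (x, u, α) ∈ convexHull ℝ (liftGraph AU) →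
      x ∈ U := by
    intro x u α h
    have hc : Convex ℝ {p : X × (X →L[ℝ] ℝ) × ℝ | p.1 ∈ U} := by
      rintro p hp q hq a b ha hb hab
      exact hUc hp hq ha hb hab
    exact convexHull_min (fun p hp => hp.1.2.1) hc h
  obtain ⟨δ, hδ, M, hM, hball, hbd⟩ := loc_bdd hB.1 ha0B
  obtain ⟨b, hb⟩ := hb_lemma (δ := δ)
    (R := zs z - zs a0 - a0s z + a0s a0 + M * (‖a0 - z‖ + δ)) hSc (by
      rintro r ⟨⟨⟨x, u, α⟩, ⟨x', v, β⟩⟩, ⟨h1, h2⟩, h3⟩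
      simp only [L, Prod.mk.injEq] at h1 h2 h3
      obtain ⟨h3, h4⟩ := h3
      obtain rfl : x = x' := sub_eq_zero.1 h3
      by_contra hr
      push Not at hr
      set Y := zs z - zs x - (u + v) z + (u + v) x with hY
      obtain ⟨τ, hτ⟩ : ∃ τ, τ = min (1 / 2) (-r / (2 * (|1 - Y| + 1))) := ⟨_, rfl⟩
      have hr' : 0 < -r := by linarith
      have hτ0 : 0 < τ := by rw [hτ]; positivity
      have hτ1 : τ ≤ 1 / 2 := by rw [hτ]; exact min_le_left _ _
      have hτ2 : τ * (2 * (|1 - Y| + 1)) ≤ -r := by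
        have : τ ≤ -r / (2 * (|1 - Y| + 1)) := by rw [hτ]; exact min_le_right _ _
        rwa [le_div_iff₀ (by positivity)] at this
      obtain ⟨a, as, bs, h5, h6, h7, h8⟩ := star_ineq hA hconv hB hU hUc ha0 ha0B ha0U
        (hUc hz (hmU h1) (by linarith : 0 ≤ 1 - τ) hτ0.le (by ring))
        ((1 - τ) • zs + τ • (u + v)) (mul_pos hτ0 hτ0)
      have h9 := two_pt z x a zs (u + v) (as + bs) (α := 1 - τ) (γ := τ) (by ring)
      have h10 := H a as bs h5 h6 h7
      have h11 := hull_rel hA.1.1 h5 (hmA h1)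
      have h12 := hull_rel hB.1 h6 h2
      rw [← hY] at h9
      have h13 : 0 ≤ (1 - τ) * (zs z - zs a - (as + bs) z + (as + bs) a) := by
        refine mul_nonneg (by linarith) ?_
        simp only [add_apply]
        linarith
      have h14 : τ * ((u + v) x - α - β) ≤
          τ * ((u + v) x - (u + v) a - (as + bs) x + (as + bs) a) := by
        refine mul_le_mul_of_nonneg_left ?_ hτ0.le
        simp only [add_apply]
        linarith
      have h15 : τ * ((u + v) x - α - β) < τ * (τ + (1 - τ) * Y) := by
        have h16 : ∀ w : X, (as + bs) w = as w + bs w := fun w => rfl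
        simp only [h16] at h9 h13 h14
        nlinarith
      have h17 := lt_of_mul_lt_mul_left h15 hτ0.le
      have h18 : τ * (1 - Y) ≤ τ * |1 - Y| := by gcongr; exact le_abs_self _
      have h19 : (u + v) z = u z + v z := rfl
      rw [h19] at hY
      linarith) hδ (by
      intro d hd
      have hn : ‖(a0 - d) - a0‖ < δ := by
        rw [sub_sub_cancel_left, norm_neg]; exact hd
      obtain ⟨cs, hcs⟩ := interior_subset (hball (mem_ball_iff_norm.2 hn))
      have hcM := hbd _ _ hcs hn
      refine ⟨_, ?_, ⟨((a0, a0s, a0s a0), (a0 - d, cs, cs (a0 - d))),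
        ⟨subset_convexHull _ _ ⟨⟨ha0s, ha0U, mem_univ _⟩, rfl⟩,
          subset_convexHull _ _ ⟨hcs, rfl⟩⟩, Prod.ext (sub_sub_cancel _ _) rfl⟩⟩
      simp only
      have h1 := (abs_le.1 (apply_le_of hcM (a0 - d - z))).2
      have h2 : ‖a0 - d - z‖ ≤ ‖a0 - z‖ + δ := by
        have := norm_sub_le (a0 - z) d
        rw [sub_right_comm] at this
        linarith
      have h3 : M * ‖a0 - d - z‖ ≤ M * (‖a0 - z‖ + δ) := by gcongr
      rw [map_sub cs (a0 - d) z] at h1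
      linarith)
  have hb' : ∀ a as c cs, (a, as) ∈ A → a ∈ U → (c, cs) ∈ B →
      0 ≤ ((zs - b) z - (zs - b) a - as z + as a) + (b z - b c - cs z + cs c) := by
    intro a as c cs h1 h2 h3
    have := hb _ _ ⟨((a, as, as a), (c, cs, cs c)),
        ⟨subset_convexHull _ _ ⟨⟨h1, h2, mem_univ _⟩, rfl⟩,
          subset_convexHull _ _ ⟨h3, rfl⟩⟩, rfl⟩
    simp only [map_sub] at this
    simp only [sub_apply]
    linarith
  have hzB : (z, b) ∈ B := by
    refine max_mem hB fun c cs hc => ?_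
    by_contra hcon
    push Not at hcon
    obtain ⟨a, as, h1, h2, h3⟩ := fpv_approx hA hU hUc ⟨a0, ha0U, ha0⟩ hz (zs - b)
      (neg_pos.2 hcon)
    have := hb' a as c cs h1 h2 hc
    linarith
  refine ⟨b, hA.2 U hU hUc ⟨a0, ha0U, ha0⟩ z _ hz ?_, hzB⟩
  rintro ⟨a, as⟩ ⟨h1, h2⟩
  have := hb' a as z b h1 h2.1 hzB
  simp only [sub_apply, map_sub] at this ⊢
  linarith

/-- the sum is of type (FPV) when `A` is (FPV) with convex domain. -/
theorem fpv_of_sum {X : Type*} [NormedAddCommGroup X] [NormedSpace ℝ X] [CompleteSpace X]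
    (A B : Set (X × (X →L[ℝ] ℝ)))
    (hA : IsMaxMonotoneOp A) (hB : IsMaxMonotoneOp B)
    (hFPV : IsFPV A) (hconv : Convex ℝ (opDom A))
    (hdom : (opDom A ∩ interior (opDom B)).Nonempty) :
    IsFPV (opSum A B) := by
  have hsum : ∀ U : Set X, IsOpen U → Convex ℝ U → (U ∩ opDom (opSum A B)).Nonempty →
      ∀ x : X, ∀ xs : X →L[ℝ] ℝ, x ∈ U →
        MonotonicallyRelated (opSum A B ∩ (U ×ˢ (univ : Set (X →L[ℝ] ℝ)))) (x, xs) →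
        (x, xs) ∈ opSum A B := by
    intro U hU hUc hne x xs hx hmr
    obtain ⟨y, hyU, ys, y1, y2, hy1, hy2, -⟩ := hne
    obtain ⟨e, heA, heB⟩ := hdom
    simp only at hy1 hy2
    obtain ⟨r, hr, hrU⟩ := Metric.isOpen_iff.1 hU y hyU
    obtain ⟨t, ht⟩ : ∃ t, t = min 1 (r / (2 * (‖e - y‖ + 1))) := ⟨_, rfl⟩
    have ht0 : 0 < t := by rw [ht]; positivity
    have ht1 : t ≤ 1 := by rw [ht]; exact min_le_left _ _
    have ht2 : t * (2 * (‖e - y‖ + 1)) ≤ r := by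
      have : t ≤ r / (2 * (‖e - y‖ + 1)) := by rw [ht]; exact min_le_right _ _
      rwa [le_div_iff₀ (by positivity)] at this
    have hmU : (1 - t) • y + t • e ∈ U := by
      refine hrU ?_
      rw [mem_ball_iff_norm, show (1 - t) • y + t • e - y = t • (e - y) by module, norm_smul,
        Real.norm_of_nonneg ht0.le]
      nlinarith [norm_nonneg (e - y)]
    obtain ⟨b, h1, h2⟩ := fpv_sum_mem hFPV hconv hB hU hUc
      (hconv ⟨y1, hy1⟩ heA (by linarith) ht0.le (by ring))
      (seg_int hB heB (subset_closure ⟨y2, hy2⟩) ht0 ht1) hmU hx xs (by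
        intro a as bs h1 h2 h3
        have := hmr (a, as + bs) ⟨⟨as, bs, h1, h2, rfl⟩, h3, mem_univ _⟩
        simp only [sub_apply, add_apply, map_sub] at this
        linarith)
    exact ⟨xs - b, b, h1, h2, by simp⟩
  refine ⟨⟨?_, ?_⟩, hsum⟩
  · rintro ⟨x, _⟩ ⟨as, bs, h1, h2, rfl⟩ ⟨y, _⟩ ⟨as', bs', h3, h4, rfl⟩
    have h5 := mono_exp hA.1 h1 h3
    have h6 := mono_exp hB.1 h2 h4
    simp only [sub_apply, add_apply, map_sub] at h5 h6 ⊢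
    linarith
  · intro C hC hsub
    refine Subset.antisymm ?_ hsub
    rintro ⟨x, xs⟩ hx
    refine hsum univ isOpen_univ convex_univ ?_ x xs (mem_univ _) ?_
    · obtain ⟨e, ⟨es, heA⟩, heB⟩ := hdom
      obtain ⟨fs, hf⟩ := interior_subset heB
      exact ⟨e, mem_univ _, es + fs, es, fs, heA, hf, rfl⟩
    · rintro p ⟨hp, -⟩
      exact hC _ hx _ (hsub hp)
end
end
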